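/- arXiv:1510.05070 — 2 statements merged into one kernel-verified Lean document; each statement's English description precedes it below -/
import Mathlib

section
/- Every graph on n vertices is ⌊4n/3⌋-list-weighted-quasi-antimagic. -/
/-- The weighted vertex sum at `v`: the weight `ω v` plus the sum of the labels `f e`
over the edges `e` of `G` incident to `v`. -/
noncomputable def weightedSum {V : Type*} [Fintype V] (G : SimpleGraph V)
    (ω : V → ℝ) (f : Sym2 V → ℝ) (v : V) : ℝ :=
  ω v + ∑ e ∈ (G.incidenceSet v).toFinite.toFinset, f e

/-- `G` is `k`-list-weighted-quasi-antimagic: for every vertex weighting `ω` and every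
list assignment `L` giving each edge a list of at least `|E(G)| + k` real numbers, there
is an edge labeling `f` with `f e ∈ L e` on edges, with pairwise distinct labels on
edges, such that any two distinct vertices that both have degree at least `1` and are
not the two vertices of a `K₂` component receive distinct weighted vertex sums. -/
def ListWeightedQuasiAntimagic {V : Type*} [Fintype V] (G : SimpleGraph V) (k : ℕ) : Prop :=
  ∀ (ω : V → ℝ) (L : Sym2 V → Finset ℝ),
    (∀ e ∈ G.edgeSet, Nat.card G.edgeSet + k ≤ (L e).card) →
    ∃ f : Sym2 V → ℝ,
      (∀ e ∈ G.edgeSet, f e ∈ L e) ∧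
      (∀ e₁ ∈ G.edgeSet, ∀ e₂ ∈ G.edgeSet, e₁ ≠ e₂ → f e₁ ≠ f e₂) ∧
      (∀ u w : V, u ≠ w →
        1 ≤ Nat.card (G.neighborSet u) → 1 ≤ Nat.card (G.neighborSet w) →
        ¬(G.Adj u w ∧ Nat.card (G.neighborSet u) = 1 ∧ Nat.card (G.neighborSet w) = 1) →
        weightedSum G ω f u ≠ weightedSum G ω f w)

open Finset MvPolynomial in
/-- The coefficients of a product of differences of variables are symmetric up to sign. -/
theorem coeff_prod_X_sub_X_symm {σ κ : Type*} (S : Finset κ) (a b : κ → σ) :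
    (∀ u v : σ →₀ ℕ,
      u + v = ∑ k ∈ S, (Finsupp.single (a k) 1 + Finsupp.single (b k) 1) →
      coeff u (∏ k ∈ S, (X (a k) - X (b k) : MvPolynomial σ ℝ)) =
        (-1) ^ #S * coeff v (∏ k ∈ S, (X (a k) - X (b k) : MvPolynomial σ ℝ))) ∧
    (∀ u : σ →₀ ℕ, coeff u (∏ k ∈ S, (X (a k) - X (b k) : MvPolynomial σ ℝ)) ≠ 0 →
      u ≤ ∑ k ∈ S, (Finsupp.single (a k) 1 + Finsupp.single (b k) 1)) := by
  classical
  induction S using Finset.induction_on with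
  | empty =>
    refine ⟨fun u v h => ?_, fun u h => ?_⟩
    · have h' : u + v = 0 := by simpa using h
      obtain ⟨rfl, rfl⟩ := add_eq_zero.1 h'
      simp
    · by_contra hu
      apply h
      have : (0 : σ →₀ ℕ) ≠ u := by
        rintro rfl
        exact hu (by simp)
      simp [MvPolynomial.coeff_one, this]
  | insert k S hk ih =>
    obtain ⟨ih1, ih2⟩ := ih
    rw [Finset.prod_insert hk, Finset.sum_insert hk, Finset.card_insert_of_notMem hk]
    set P := (∏ k ∈ S, (X (a k) - X (b k) : MvPolynomial σ ℝ))
    set d := ∑ k ∈ S, (Finsupp.single (a k) 1 + Finsupp.single (b k) 1)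
    have key : ∀ (i j : σ) (u v : σ →₀ ℕ),
        u + v = (Finsupp.single i 1 + Finsupp.single j 1) + d →
        coeff u (X i * P) = (-1) ^ #S * coeff v (X j * P) := by
      intro i j u v huv
      have huv' : ∀ t, u t + v t = Finsupp.single i 1 t + Finsupp.single j 1 t + d t := fun t => by
        rw [← Finsupp.add_apply, huv]; simp
      rw [coeff_X_mul', coeff_X_mul']
      by_cases hu : u i = 0
      · rw [if_neg (by simpa using hu)]
        split_ifs with hv
        · by_contra hne
          have hle := ih2 (v - Finsupp.single j 1) (fun h0 => hne (by rw [h0, mul_zero])) i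
          have := huv' i
          simp [Finsupp.tsub_apply, hu] at this hle
          omega
        · simp
      · rw [if_pos (by simpa using hu)]
        by_cases hv : v j = 0
        · rw [if_neg (by simpa using hv)]
          by_contra hne
          have hle := ih2 (u - Finsupp.single i 1) (fun h0 => hne (by rw [h0, mul_zero])) j
          have := huv' j
          simp [Finsupp.tsub_apply, hv] at this hle
          omega
        · rw [if_pos (by simpa using hv)]
          apply ih1
          ext t
          have := huv' t
          have h1 : Finsupp.single i 1 t ≤ u t := by
            by_cases h : i = t
            · subst h; simp; omega
            · simp [h]
          have h2 : Finsupp.single j 1 t ≤ v t := by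
            by_cases h : j = t
            · subst h; simp; omega
            · simp [h]
          simp only [Finsupp.add_apply, Finsupp.tsub_apply]
          omega
    refine ⟨fun u v huv => ?_, fun u hu => ?_⟩
    · rw [sub_mul, coeff_sub, coeff_sub, key (a k) (b k) u v huv,
        key (b k) (a k) u v (by rw [huv, add_comm (Finsupp.single (a k) 1)])]
      ring
    · rw [sub_mul, coeff_sub] at hu
      have : coeff u (X (a k) * P) ≠ 0 ∨ coeff u (X (b k) * P) ≠ 0 := by
        by_contra! h
        exact hu (by rw [h.1, h.2, sub_zero])
      rcases this with h | h <;> rw [coeff_X_mul'] at h <;> split_ifs at h <;>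
        [skip; exact absurd rfl h; skip; exact absurd rfl h] <;>
      · intro t
        have := ih2 _ h t
        simp only [Finsupp.tsub_apply, Finsupp.add_apply] at this ⊢
        omega

open Finset MvPolynomial in
/-- Subtracting constants from the factors does not change the top coefficients. -/
theorem coeff_prod_X_sub_X_sub_C {σ κ : Type*} (S : Finset κ) (a b : κ → σ) (c : κ → ℝ) :
    (∏ k ∈ S, (X (a k) - X (b k) - C (c k) : MvPolynomial σ ℝ)).totalDegree ≤ #S ∧
    ∀ u : σ →₀ ℕ, #S ≤ u.degree →
      coeff u (∏ k ∈ S, (X (a k) - X (b k) - C (c k) : MvPolynomial σ ℝ)) =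
        coeff u (∏ k ∈ S, (X (a k) - X (b k) : MvPolynomial σ ℝ)) := by
  classical
  induction S using Finset.induction_on with
  | empty => simp
  | insert k S hk ih =>
    obtain ⟨ih1, ih2⟩ := ih
    rw [Finset.prod_insert hk, Finset.prod_insert hk, Finset.card_insert_of_notMem hk]
    set P := (∏ k ∈ S, (X (a k) - X (b k) : MvPolynomial σ ℝ))
    set Q := (∏ k ∈ S, (X (a k) - X (b k) - C (c k) : MvPolynomial σ ℝ))
    refine ⟨?_, fun u hu => ?_⟩
    · refine (totalDegree_mul _ _).trans ?_
      have : (X (a k) - X (b k) - C (c k) : MvPolynomial σ ℝ).totalDegree ≤ 1 := by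
        refine (totalDegree_sub_C_le _ _).trans ((totalDegree_sub _ _).trans ?_)
        simp
      omega
    · have hX : ∀ i : σ, coeff u (X i * Q) = coeff u (X i * P) := by
        intro i
        rw [coeff_X_mul', coeff_X_mul']
        split_ifs with h
        · apply ih2
          have h1 : Finsupp.single i 1 ≤ u := by
            rw [Finsupp.single_le_iff]
            have : u i ≠ 0 := by simpa using h
            omega
          have h2 : (u - Finsupp.single i 1 + Finsupp.single i 1).degree = u.degree := by
            rw [tsub_add_cancel_of_le h1]
          rw [map_add, Finsupp.degree_single] at h2
          omega
        · rfl
      have hQ : coeff u Q = 0 := by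
        apply coeff_eq_zero_of_totalDegree_lt
        have : ∑ i ∈ u.support, u i = u.degree := rfl
        omega
      rw [sub_mul, sub_mul, sub_mul, coeff_sub, coeff_sub, coeff_sub, hX, hX, coeff_C_mul, hQ]
      ring

open Finset MvPolynomial in
/-- Reals can be chosen from lists so as to avoid an even number of prescribed differences for
each pair in a family, when each list is longer than the number of pairs meeting its index. -/
theorem exists_mem_sub_ne {σ κ : Type*} [Finite σ] (S : Finset κ) (a b : κ → σ)
    (hab : ∀ k ∈ S, a k ≠ b k) (c : κ × Fin 2 → ℝ) (L : σ → Finset ℝ)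
    (hL : ∀ i, (∑ k ∈ S, (Finsupp.single (a k) 1 + Finsupp.single (b k) 1) : σ →₀ ℕ) i < #(L i)) :
    ∃ y : σ → ℝ, (∀ i, y i ∈ L i) ∧ ∀ k ∈ S, ∀ t, y (a k) - y (b k) ≠ c (k, t) := by
  classical
  set d : σ →₀ ℕ := ∑ k ∈ S, (Finsupp.single (a k) 1 + Finsupp.single (b k) 1) with hd
  set P := (∏ k ∈ S, (X (a k) - X (b k) : MvPolynomial σ ℝ)) with hP
  set Q := (∏ k ∈ S ×ˢ (univ : Finset (Fin 2)),
    (X (a k.1) - X (b k.1) - C (c k) : MvPolynomial σ ℝ)) with hQ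
  have hdeg : d.degree = 2 * #S := by
    simp [hd, map_sum, Finsupp.degree_single, mul_comm]
  have hcard : #(S ×ˢ (univ : Finset (Fin 2))) = 2 * #S := by
    rw [card_product]; simp [mul_comm]
  obtain ⟨h1, h2⟩ := coeff_prod_X_sub_X_sub_C (S ×ˢ (univ : Finset (Fin 2)))
    (fun k => a k.1) (fun k => b k.1) c
  obtain ⟨h3, h4⟩ := coeff_prod_X_sub_X_symm S a b
  have hPP : (∏ k ∈ S ×ˢ (univ : Finset (Fin 2)),
      (X (a k.1) - X (b k.1) : MvPolynomial σ ℝ)) = P * P := by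
    rw [Finset.prod_product, hP, ← Finset.prod_mul_distrib]
    exact Finset.prod_congr rfl fun k _ => by simp [sq]
  have hcoeff : coeff d Q ≠ 0 := by
    rw [hQ, h2 d (by rw [hcard, hdeg]), hPP, coeff_mul]
    have hsum : ∑ x ∈ antidiagonal d, coeff x.1 P * coeff x.2 P =
        (-1) ^ #S * ∑ x ∈ antidiagonal d, coeff x.2 P ^ 2 := by
      rw [mul_sum]
      refine Finset.sum_congr rfl fun x hx => ?_
      rw [h3 x.1 x.2 (mem_antidiagonal.1 hx)]
      ring
    rw [hsum]
    refine mul_ne_zero (by simp) (ne_of_gt ?_)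
    have hP0 : P ≠ 0 := by
      refine Finset.prod_ne_zero_iff.2 fun k hk => sub_ne_zero.2 fun h => hab k hk ?_
      exact X_injective h
    obtain ⟨u, hu⟩ := ne_zero_iff.1 hP0
    refine Finset.sum_pos' (fun _ _ => sq_nonneg _) ⟨(d - u, u), ?_, by positivity⟩
    rw [HasAntidiagonal.mem_antidiagonal]
    exact tsub_add_cancel_of_le (h4 u hu)
  have htot : Q.totalDegree = d.degree := by
    refine le_antisymm (by rw [hdeg, ← hcard]; exact h1) ?_
    exact le_totalDegree (mem_support_iff.2 hcoeff)
  obtain ⟨y, hy, hne⟩ := combinatorial_nullstellensatz_exists_eval_nonzero Q d hcoeff htot L hL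
  refine ⟨y, hy, fun k hk t h => hne ?_⟩
  rw [hQ, eval_prod]
  exact Finset.prod_eq_zero (i := (k, t)) (mem_product.2 ⟨hk, mem_univ t⟩) (by simp [h])

open Finset in
/-- Reals `y i` chosen from lists of more than `3 * (q - 1)` elements can avoid six prescribed
differences for each pair of indices. -/
theorem exists_mem_six_sub_ne {q : ℕ} (c : Fin q → Fin q → Fin 3 × Fin 2 → ℝ)
    (L : Fin q → Finset ℝ) (hL : ∀ i, 3 * (q - 1) < #(L i)) :
    ∃ y : Fin q → ℝ, (∀ i, y i ∈ L i) ∧ ∀ i j, i < j → ∀ t, y i - y j ≠ c i j t := by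
  classical
  obtain ⟨y, hy, hne⟩ := exists_mem_sub_ne
    (((univ : Finset (Fin q × Fin q)).filter fun p => p.1 < p.2) ×ˢ (univ : Finset (Fin 3)))
    (fun k => k.1.1) (fun k => k.1.2)
    (fun k hk => ne_of_lt (by simpa using hk))
    (fun k => c k.1.1.1 k.1.1.2 (k.1.2, k.2)) L (fun i => by
      refine lt_of_le_of_lt ?_ (hL i)
      rw [sum_product]
      simp only [Finsupp.coe_finsetSum, Finset.sum_apply, Finsupp.add_apply, sum_const,
        Finsupp.coe_smul, Pi.smul_apply, smul_eq_mul, card_univ, Fintype.card_fin]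
      rw [← mul_sum]
      refine Nat.mul_le_mul_left 3 ?_
      have hsub : ∑ p ∈ ((univ : Finset (Fin q × Fin q)).filter fun p => p.1 < p.2),
          (Finsupp.single p.1 1 i + Finsupp.single p.2 1 i) =
          #((univ : Finset (Fin q × Fin q)).filter fun p => p.1 < p.2 ∧ (p.1 = i ∨ p.2 = i)) := by
        rw [← filter_filter, card_filter]
        refine sum_congr rfl fun p hp => ?_
        have hp' : p.1 < p.2 := by simpa using hp
        by_cases h1 : p.1 = i
        · have h2 : p.2 ≠ i := by rintro rfl; exact hp'.ne h1
          simp [h1, h2]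
        · simp [Finsupp.single_apply, h1]
      rw [hsub]
      have : q - 1 = #((univ : Finset (Fin q)).erase i) := by simp
      rw [this]
      refine card_le_card_of_injOn (fun p => if p.1 = i then p.2 else p.1) ?_ ?_
      · rintro ⟨x, z⟩ hp
        simp only [coe_filter, mem_univ, true_and, Set.mem_ofPred_eq] at hp
        simp only [coe_erase, coe_univ, Set.mem_sdiff, Set.mem_univ, true_and,
          Set.mem_singleton_iff]
        split_ifs with h
        · rintro rfl
          exact hp.1.ne h
        · exact h
      · rintro ⟨x, z⟩ hp ⟨x', z'⟩ hp' h
        simp only [coe_filter, mem_univ, true_and, Set.mem_ofPred_eq] at hp hp'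
        simp only [Prod.mk.injEq] at h ⊢
        split_ifs at h <;> grind)
  refine ⟨y, hy, fun i j hij t => ?_⟩
  exact hne ((i, j), t.1) (by simpa using hij) t.2

open Finset in
/-- If three lists of reals are long compared with a set `D`, one can pick a triple with sum
outside `D` that is compatible with respect to relations of bounded degree. -/
theorem exists_triple_sum_notMem (X Y Z D : Finset ℝ) (l : ℕ)
    (hX : l ≤ #X) (hY : l ≤ #Y) (hZ : l ≤ #Z) (hl : 8 ≤ l) (hD : #D + 21 ≤ 3 * l)
    (bXY bXZ bYZ bYX bZX bZY : ℝ → Finset ℝ)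
    (hXY : ∀ x, #(bXY x) ≤ 3) (hXZ : ∀ x, #(bXZ x) ≤ 3) (hYZ : ∀ x, #(bYZ x) ≤ 3)
    (hYX : ∀ x, #(bYX x) ≤ 3) (hZX : ∀ x, #(bZX x) ≤ 3) (hZY : ∀ x, #(bZY x) ≤ 3)
    (sXY : ∀ x y, y ∈ bXY x ↔ x ∈ bYX y) (sXZ : ∀ x z, z ∈ bXZ x ↔ x ∈ bZX z)
    (sYZ : ∀ y z, z ∈ bYZ y ↔ y ∈ bZY z) :
    ∃ x ∈ X, ∃ y ∈ Y, ∃ z ∈ Z, y ∉ bXY x ∧ z ∉ bXZ x ∧ z ∉ bYZ y ∧ x + y + z ∉ D := by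
  classical
  obtain ⟨z₁, hz₁, hz₁min⟩ := exists_min_image Z id (card_pos.1 (by omega))
  have cY0 := le_card_sdiff (bZY z₁) Y
  have := hZY z₁
  obtain ⟨y₁, hy₁, hy₁min⟩ := exists_min_image (Y \ bZY z₁) id (card_pos.1 (by omega))
  have cX1 := le_card_sdiff (bYX y₁) X
  have cX2 := le_card_sdiff (bZX z₁) (X \ bYX y₁)
  have := hYX y₁
  have := hZX z₁
  set X₁ := (X \ bYX y₁) \ bZX z₁ with hX₁
  obtain ⟨x₂, hx₂, hx₂max⟩ := exists_max_image X₁ id (card_pos.1 (by omega))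
  set Y₁ := (Y \ bZY z₁) \ bXY x₂ with hY₁
  have hy₁Y : y₁ ∈ Y₁ := by
    simp only [hX₁, hY₁, mem_sdiff] at *
    exact ⟨hy₁, fun h => hx₂.1.2 ((sXY _ _).1 h)⟩
  have cY1 := le_card_sdiff (bXY x₂) (Y \ bZY z₁)
  rw [← hY₁] at cY1
  have := hXY x₂
  obtain ⟨y₂, hy₂, hy₂max⟩ := exists_max_image Y₁ id ⟨y₁, hy₁Y⟩
  set Z₁ := (Z \ bXZ x₂) \ bYZ y₂ with hZ₁
  have hz₁Z : z₁ ∈ Z₁ := by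
    simp only [hX₁, hY₁, hZ₁, mem_sdiff] at *
    exact ⟨⟨hz₁, fun h => hx₂.2 ((sXZ _ _).1 h)⟩, fun h => hy₂.1.2 ((sYZ _ _).1 h)⟩
  have cZ1 := le_card_sdiff (bXZ x₂) Z
  have cZ2 := le_card_sdiff (bYZ y₂) (Z \ bXZ x₂)
  rw [← hZ₁] at cZ2
  have := hXZ x₂
  have := hYZ y₂
  have cY2 := card_erase_of_mem hy₁Y
  have cZ3 := card_erase_of_mem hz₁Z
  set S₁ := X₁.image (fun x => x + y₁ + z₁) with hS₁
  set S₂ := (Y₁.erase y₁).image (fun y => x₂ + y + z₁) with hS₂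
  set S₃ := (Z₁.erase z₁).image (fun z => x₂ + y₂ + z) with hS₃
  have c1 : #S₁ = #X₁ := card_image_of_injective _ fun s t h => by simpa using h
  have c2 : #S₂ = #(Y₁.erase y₁) := card_image_of_injective _ fun s t h => by simpa using h
  have c3 : #S₃ = #(Z₁.erase z₁) := card_image_of_injective _ fun s t h => by simpa using h
  have b1 : ∀ s ∈ S₁, s ≤ x₂ + y₁ + z₁ := by
    simp only [hS₁, mem_image]
    rintro _ ⟨x, hx, rfl⟩
    have := hx₂max x hx
    simp only [id] at this
    linarith
  have b2 : ∀ s ∈ S₂, x₂ + y₁ + z₁ < s ∧ s ≤ x₂ + y₂ + z₁ := by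
    simp only [hS₂, mem_image, mem_erase]
    rintro _ ⟨y, ⟨hne, hy⟩, rfl⟩
    have h1 := hy₁min y (mem_sdiff.1 hy).1
    have h2 := hy₂max y hy
    simp only [id] at h1 h2
    have := lt_of_le_of_ne h1 (Ne.symm hne)
    constructor <;> linarith
  have b3 : ∀ s ∈ S₃, x₂ + y₂ + z₁ < s := by
    simp only [hS₃, mem_image, mem_erase]
    rintro _ ⟨z, ⟨hne, hz⟩, rfl⟩
    have h1 := hz₁min z (by simp only [hZ₁, mem_sdiff] at hz; exact hz.1.1)
    simp only [id] at h1
    have := lt_of_le_of_ne h1 (Ne.symm hne)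
    linarith
  have hy₁₂ : y₁ ≤ y₂ := hy₂max y₁ hy₁Y
  have d12 : Disjoint S₁ S₂ := disjoint_left.2 fun s h h' => by
    have := b1 s h
    have := (b2 s h').1
    linarith
  have d3 : Disjoint (S₁ ∪ S₂) S₃ := disjoint_left.2 fun s h h' => by
    have h3 := b3 s h'
    rcases mem_union.1 h with h | h
    · have := b1 s h
      linarith
    · have := (b2 s h).2
      linarith
  have hcard : #D < #(S₁ ∪ S₂ ∪ S₃) := by
    rw [card_union_of_disjoint d3, card_union_of_disjoint d12]
    omega
  obtain ⟨s, hs, hsD⟩ := exists_mem_notMem_of_card_lt_card hcard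
  simp only [mem_union, hS₁, hS₂, hS₃, mem_image, mem_erase] at hs
  simp only [hX₁, hY₁, hZ₁, mem_sdiff] at *
  rcases hs with (⟨x, hx, rfl⟩ | ⟨y, hy, rfl⟩) | ⟨z, hz, rfl⟩
  · exact ⟨x, hx.1.1, y₁, hy₁.1, z₁, hz₁, by rw [sXY]; exact hx.1.2, by rw [sXZ]; exact hx.2,
      by rw [sYZ]; exact hy₁.2, hsD⟩
  · exact ⟨x₂, hx₂.1.1, y, hy.2.1.1, z₁, hz₁, hy.2.2, by rw [sXZ]; exact hx₂.2,
      by rw [sYZ]; exact hy.2.1.2, hsD⟩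
  · exact ⟨x₂, hx₂.1.1, y₂, hy₂.1.1, z, hz.2.1.1, hy₂.2, hz.2.1.2, hz.2.2, hsD⟩

/-- The weighted sum at `v` of the labels on the edges in `T` only. -/
noncomputable def partialSum {V : Type*} [DecidableEq V] (ω : V → ℝ) (T : Finset (Sym2 V))
    (f : Sym2 V → ℝ) (v : V) : ℝ :=
  ω v + ∑ e ∈ T with v ∈ e, f e

/-- `v` is not isolated in the graph with edge set `E` and all its edges lie in `T`. -/
def IsSaturated {V : Type*} (E T : Finset (Sym2 V)) (v : V) : Prop :=
  (∃ e ∈ E, v ∈ e) ∧ ∀ e ∈ E, v ∈ e → e ∈ T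

/-- The vertices `u` and `w` have to be distinguished once the edges in `T` are labeled: either
both are saturated (and they do not form a `K₂` component), or they are joined by an edge of `F`
and one of them meets `T`. -/
def MustDiffer {V : Type*} (E F T : Finset (Sym2 V)) (u w : V) : Prop :=
  (IsSaturated E T u ∧ IsSaturated E T w ∧ ¬∀ e ∈ E, (u ∈ e ∨ w ∈ e) → e = s(u, w)) ∨
    (s(u, w) ∈ F ∧ ∃ e ∈ T, u ∈ e ∨ w ∈ e)

/-- `f` is an admissible labeling of the edges in `T`. -/
structure IsPartialLabeling {V : Type*} [DecidableEq V] (E : Finset (Sym2 V)) (ω : V → ℝ)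
    (L : Sym2 V → Finset ℝ) (F T : Finset (Sym2 V)) (f : Sym2 V → ℝ) : Prop where
  mem_list : ∀ e ∈ T, f e ∈ L e
  injOn : Set.InjOn f T
  sum_ne : ∀ u w, u ≠ w → MustDiffer E F T u w → partialSum ω T f u ≠ partialSum ω T f w

/-- Distinct edges in `F` are disjoint. -/
def IsEdgeMatching {V : Type*} (F : Finset (Sym2 V)) : Prop :=
  ∀ e ∈ F, ∀ e' ∈ F, ∀ v, v ∈ e → v ∈ e' → e = e'

theorem MustDiffer.symm {V : Type*} {E F T : Finset (Sym2 V)} {u w : V}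
    (h : MustDiffer E F T u w) : MustDiffer E F T w u := by
  unfold MustDiffer at *
  rw [Sym2.eq_swap (a := w)]
  simp only [or_comm (a := w ∈ _)]
  exact h.imp (fun h' => ⟨h'.2.1, h'.1, h'.2.2⟩) id

theorem partialSum_insert_update {V : Type*} [DecidableEq V] (ω : V → ℝ) {T : Finset (Sym2 V)}
    (f : Sym2 V → ℝ) {e : Sym2 V} (he : e ∉ T) (x : ℝ) (v : V) :
    partialSum ω (insert e T) (Function.update f e x) v =
      partialSum ω T f v + if v ∈ e then x else 0 := by
  unfold partialSum
  have h : ∑ e' ∈ T with v ∈ e', Function.update f e x e' = ∑ e' ∈ T with v ∈ e', f e' := by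
    refine Finset.sum_congr rfl fun e' he' => ?_
    rw [Function.update_of_ne]
    rintro rfl
    exact he (Finset.mem_filter.1 he').1
  rw [Finset.filter_insert]
  split_ifs with hv
  · rw [Finset.sum_insert (by simp [he]), h, Function.update_self]
    ring
  · rw [h, add_zero]

theorem IsSaturated.of_insert {V : Type*} [DecidableEq V] {E T : Finset (Sym2 V)} {e : Sym2 V}
    {v : V} (h : IsSaturated E (insert e T) v) (hv : v ∉ e) : IsSaturated E T v := by
  refine ⟨h.1, fun e' he' hv' => ?_⟩
  rcases Finset.mem_insert.1 (h.2 e' he' hv') with rfl | h'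
  · exact absurd hv' hv
  · exact h'

theorem MustDiffer.of_insert {V : Type*} [DecidableEq V] {E F T : Finset (Sym2 V)} {e : Sym2 V}
    {u w : V} (h : MustDiffer E F (insert e T) u w) (hu : u ∉ e) (hw : w ∉ e) :
    MustDiffer E F T u w := by
  rcases h with ⟨h1, h2, h3⟩ | ⟨h1, e', he', h2⟩
  · exact Or.inl ⟨h1.of_insert hu, h2.of_insert hw, h3⟩
  · refine Or.inr ⟨h1, e', ?_, h2⟩
    rcases Finset.mem_insert.1 he' with rfl | h'
    · tauto
    · exact h'

open Finset Classical in
/-- A single edge can be labeled greedily if it saturates at most one of its ends. -/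
theorem IsPartialLabeling.exists_insert {V : Type*} [Fintype V] [DecidableEq V]
    {E : Finset (Sym2 V)} {ω : V → ℝ} {L : Sym2 V → Finset ℝ} {F T : Finset (Sym2 V)}
    {f : Sym2 V → ℝ} (hf : IsPartialLabeling E ω L F T f) (hF : IsEdgeMatching F)
    {v w : V} (hvw : v ≠ w) (he : s(v, w) ∉ T) (hdisj : Disjoint F (insert s(v, w) T))
    (hsat : ¬(IsSaturated E (insert s(v, w) T) v ∧ IsSaturated E (insert s(v, w) T) w))
    (hL : #T + Fintype.card V ≤ #(L s(v, w))) :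
    ∃ f', IsPartialLabeling E ω L F (insert s(v, w) T) f' := by
  set T' := insert s(v, w) T with hT'
  set N : V → Finset V := fun z => {u | u ≠ v ∧ u ≠ w ∧ MustDiffer E F T' z u} with hN
  have hN2 : ∀ z, #(N z) ≤ Fintype.card V - 2 := by
    intro z
    have : N z ⊆ univ \ {v, w} := by
      intro u
      simp only [hN, mem_filter, mem_univ, true_and, mem_sdiff, mem_insert, mem_singleton]
      tauto
    refine (card_le_card this).trans ?_
    rw [card_sdiff_of_subset (subset_univ _), card_pair hvw, card_univ]
  have hV : 2 ≤ Fintype.card V := by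
    rw [← card_pair hvw]
    exact card_le_univ _
  have hN1 : ∀ z, ¬IsSaturated E T' z → #(N z) ≤ 1 := by
    intro z hz
    rw [card_le_one]
    intro a ha b hb
    simp only [hN, mem_filter, mem_univ, true_and] at ha hb
    have ha' : s(z, a) ∈ F := by
      rcases ha.2.2 with h | h
      · exact absurd h.1 hz
      · exact h.1
    have hb' : s(z, b) ∈ F := by
      rcases hb.2.2 with h | h
      · exact absurd h.1 hz
      · exact h.1
    have := hF _ ha' _ hb' z (Sym2.mem_mk_left _ _) (Sym2.mem_mk_left _ _)
    exact Sym2.congr_right.1 this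
  have hNcard : #(N v) + #(N w) < Fintype.card V := by
    have h1 := hN2 v
    have h2 := hN2 w
    by_cases h : IsSaturated E T' v
    · have := hN1 w fun h' => hsat ⟨h, h'⟩
      omega
    · have := hN1 v h
      omega
  set B : Finset ℝ := T.image f ∪
    ((N v).image (fun u => partialSum ω T f u - partialSum ω T f v) ∪
      (N w).image (fun u => partialSum ω T f u - partialSum ω T f w)) with hB
  have hBcard : #B < #(L s(v, w)) := by
    have h1 := card_union_le (T.image f)
      ((N v).image (fun u => partialSum ω T f u - partialSum ω T f v) ∪
        (N w).image (fun u => partialSum ω T f u - partialSum ω T f w))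
    have h2 := card_union_le ((N v).image (fun u => partialSum ω T f u - partialSum ω T f v))
        ((N w).image (fun u => partialSum ω T f u - partialSum ω T f w))
    have h3 : #(T.image f) ≤ #T := card_image_le
    have h4 : #((N v).image (fun u => partialSum ω T f u - partialSum ω T f v)) ≤ #(N v) :=
      card_image_le
    have h5 : #((N w).image (fun u => partialSum ω T f u - partialSum ω T f w)) ≤ #(N w) :=
      card_image_le
    rw [← hB] at h1
    omega
  obtain ⟨x, hxL, hxB⟩ := exists_mem_notMem_of_card_lt_card hBcard
  simp only [hB, mem_union, mem_image, not_or, not_exists, not_and] at hxB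
  obtain ⟨hxT, hxv, hxw⟩ := hxB
  have hne : ∀ e ∈ T, e ≠ s(v, w) := by
    rintro e h rfl
    exact he h
  have hend : ∀ z, z ∈ s(v, w) → ∀ u, u ∉ s(v, w) → MustDiffer E F T' z u →
      partialSum ω T f z + x ≠ partialSum ω T f u := by
    intro z hz u hu hzu heq
    have hu' : u ≠ v ∧ u ≠ w := by simpa using hu
    have huN : u ∈ N z := by
      simp only [hN, mem_filter, mem_univ, true_and]
      exact ⟨hu'.1, hu'.2, hzu⟩
    rcases Sym2.mem_iff.1 hz with rfl | rfl
    · exact hxv u huN (by linarith)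
    · exact hxw u huN (by linarith)
  have hpair : ¬MustDiffer E F T' v w := by
    rintro (h | h)
    · exact hsat ⟨h.1, h.2.1⟩
    · exact disjoint_left.1 hdisj h.1 (mem_insert_self _ _)
  refine ⟨Function.update f s(v, w) x, ?_, ?_, ?_⟩
  · intro e h
    rcases mem_insert.1 h with rfl | h
    · rwa [Function.update_self]
    · rw [Function.update_of_ne (hne e h)]
      exact hf.mem_list e h
  · intro e₁ h₁ e₂ h₂ h
    rcases mem_insert.1 (mem_coe.1 h₁) with rfl | h₁ <;>
      rcases mem_insert.1 (mem_coe.1 h₂) with rfl | h₂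
    · rfl
    · rw [Function.update_self, Function.update_of_ne (hne _ h₂)] at h
      exact absurd h.symm (hxT _ h₂)
    · rw [Function.update_self, Function.update_of_ne (hne _ h₁)] at h
      exact absurd h (hxT _ h₁)
    · rw [Function.update_of_ne (hne _ h₁), Function.update_of_ne (hne _ h₂)] at h
      exact hf.injOn h₁ h₂ h
  · intro a b hab hd
    rw [partialSum_insert_update ω f he, partialSum_insert_update ω f he]
    by_cases ha : a ∈ s(v, w) <;> by_cases hb : b ∈ s(v, w)
    · exfalso
      rcases Sym2.mem_iff.1 ha with rfl | rfl <;> rcases Sym2.mem_iff.1 hb with rfl | rfl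
      · exact hab rfl
      · exact hpair hd
      · exact hpair hd.symm
      · exact hab rfl
    · rw [if_pos ha, if_neg hb, add_zero]
      exact hend a ha b hb hd
    · rw [if_neg ha, if_pos hb, add_zero]
      exact (hend b hb a ha hd.symm).symm
    · rw [if_neg ha, if_neg hb, add_zero, add_zero]
      exact hf.sum_ne a b hab (hd.of_insert ha hb)

open Finset in
/-- All edges of `T \ S` can be labeled greedily when every vertex they meet either keeps an
unlabeled edge or has a neighbor of smaller rank. -/
theorem IsPartialLabeling.exists_of_rank {V : Type*} [Fintype V] [DecidableEq V]
    {E : Finset (Sym2 V)} {ω : V → ℝ} {L : Sym2 V → Finset ℝ} {F S : Finset (Sym2 V)}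
    (hE : ∀ e ∈ E, ¬e.IsDiag) (hL : ∀ e ∈ E, #E + Fintype.card V ≤ #(L e))
    {f : Sym2 V → ℝ} (hf : IsPartialLabeling E ω L F S f) (hF : IsEdgeMatching F)
    (r : V → ℕ) (T : Finset (Sym2 V)) (hST : S ⊆ T) (hTE : T ⊆ E) (hFT : Disjoint F T)
    (h : ∀ e ∈ T \ S, ∀ v ∈ e, ∃ w, s(v, w) ∈ E ∧ s(v, w) ∉ S ∧ (s(v, w) ∉ T ∨ r w < r v)) :
    ∃ f', IsPartialLabeling E ω L F T f' := by
  induction T using Finset.strongInduction with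
  | H T ih =>
    by_cases hTS : T = S
    · exact ⟨f, hTS ▸ hf⟩
    obtain ⟨e₀, he₀T, he₀S⟩ : ∃ e ∈ T, e ∉ S := by
      by_contra! hcon
      exact hTS (Subset.antisymm hcon hST)
    have hne : ((univ : Finset (V × V)).filter fun p => s(p.1, p.2) ∈ T \ S).Nonempty := by
      induction e₀ using Sym2.ind with
      | _ a b => exact ⟨(a, b), by simp [he₀T, he₀S]⟩
    obtain ⟨⟨v, w⟩, hvw, hmin⟩ := exists_min_image _ (fun p : V × V => r p.2) hne
    simp only [mem_filter, mem_univ, true_and, Prod.forall] at hvw hmin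
    obtain ⟨heT, heS⟩ := mem_sdiff.1 hvw
    have hins : insert s(v, w) (T.erase s(v, w)) = T := insert_erase heT
    obtain ⟨f', hf'⟩ := ih (T.erase s(v, w)) (erase_ssubset heT)
      (fun e he => mem_erase.2 ⟨fun h0 => heS (h0 ▸ he), hST he⟩)
      ((erase_subset _ _).trans hTE) (hFT.mono_right (erase_subset _ _)) (by
        intro e he z hz
        obtain ⟨u, h1, h2, h3⟩ := h e
          (mem_sdiff.2 ⟨erase_subset _ _ (mem_sdiff.1 he).1, (mem_sdiff.1 he).2⟩) z hz
        exact ⟨u, h1, h2, h3.imp (fun h4 h5 => h4 (erase_subset _ _ h5)) id⟩)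
    rw [← hins]
    refine hf'.exists_insert hF ?_ (by simp) (by rwa [hins]) ?_ ?_
    · intro h0
      exact hE _ (hTE heT) (by simpa using h0)
    · rw [hins]
      rintro ⟨-, hw⟩
      obtain ⟨u, h1, h2, h3⟩ := h _ hvw w (Sym2.mem_mk_right _ _)
      have h4 := hw.2 _ h1 (Sym2.mem_mk_left _ _)
      rcases h3 with h3 | h3
      · exact h3 h4
      · have := hmin w u (mem_sdiff.2 ⟨h4, h2⟩)
        omega
    · have h1 := card_le_card ((erase_subset s(v, w) T).trans hTE)
      have h2 := hL _ (hTE heT)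
      omega

open Finset Classical in
/-- The edges of a matching can be labeled simultaneously. -/
theorem IsPartialLabeling.exists_union_matching {V : Type*} [Fintype V] [DecidableEq V]
    {E : Finset (Sym2 V)} {ω : V → ℝ} {L : Sym2 V → Finset ℝ} {M T : Finset (Sym2 V)}
    {f : Sym2 V → ℝ} (hf : IsPartialLabeling E ω L M T f) (hM : IsEdgeMatching M)
    (hMT : Disjoint M T)
    (hL : ∀ e ∈ M, #T + 2 * #{v | IsSaturated E T v} + 3 * (#M - 1) < #(L e)) :
    ∃ f', IsPartialLabeling E ω L ∅ (T ∪ M) f' := by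
  set D : Finset V := {v | IsSaturated E T v} with hD
  set q := #M with hq
  set φ : M ≃ Fin q := M.equivFin
  set p : V → ℝ := partialSum ω T f with hp
  have hends : ∀ e : Sym2 V, ∃ v w, e = s(v, w) := fun e => by
    induction e using Sym2.ind with
    | _ a b => exact ⟨a, b, rfl⟩
  choose b₀ c₀ hbc₀ using hends
  set g : Fin q → Sym2 V := fun i => (φ.symm i).1 with hg
  have hgM : ∀ i, g i ∈ M := fun i => (φ.symm i).2
  have hginj : ∀ i j, g i = g j → i = j := fun i j h => φ.symm.injective (Subtype.ext h)
  set b : Fin q → V := fun i => b₀ (g i)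
  set c : Fin q → V := fun i => c₀ (g i)
  have hbc : ∀ i, g i = s(b i, c i) := fun i => hbc₀ (g i)
  obtain ⟨y, hyL, hyne⟩ := exists_mem_six_sub_ne
    (fun i j t => if t.1 = 0 then 0 else
      (if t.2 = 0 then p (b j) else p (c j)) - (if t.1 = 1 then p (b i) else p (c i)))
    (fun i => L (g i) \ (T.image f ∪
      (D.image (fun u => p u - p (b i)) ∪ D.image (fun u => p u - p (c i))))) (fun i => by
      have h0 := hL _ (hgM i)
      have h1 := card_union_le (T.image f)
        (D.image (fun u => p u - p (b i)) ∪ D.image (fun u => p u - p (c i)))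
      have h2 := card_union_le (D.image (fun u => p u - p (b i)))
        (D.image (fun u => p u - p (c i)))
      have h3 : #(T.image f) ≤ #T := card_image_le
      have h4 : #(D.image (fun u => p u - p (b i))) ≤ #D := card_image_le
      have h5 : #(D.image (fun u => p u - p (c i))) ≤ #D := card_image_le
      have h6 := le_card_sdiff (T.image f ∪
        (D.image (fun u => p u - p (b i)) ∪ D.image (fun u => p u - p (c i)))) (L (g i))
      omega)
  simp only [mem_sdiff, mem_union, mem_image, not_or, not_exists, not_and] at hyL
  have hylt : ∀ i j, i < j → y i ≠ y j ∧ ∀ u ∈ g i, ∀ w ∈ g j, p u + y i ≠ p w + y j := by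
    intro i j hij
    refine ⟨fun h => hyne i j hij (0, 0) (by simp [h]), fun u hu w hw h => ?_⟩
    rw [hbc, Sym2.mem_iff] at hu hw
    rcases hu with rfl | rfl <;> rcases hw with rfl | rfl
    · exact hyne i j hij (1, 0) (by simp; linarith)
    · exact hyne i j hij (1, 1) (by simp; linarith)
    · exact hyne i j hij (2, 0) (by simp; linarith)
    · exact hyne i j hij (2, 1) (by simp; linarith)
  have hyij : ∀ i j, i ≠ j → y i ≠ y j ∧ ∀ u ∈ g i, ∀ w ∈ g j, p u + y i ≠ p w + y j := by
    intro i j hij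
    rcases lt_or_gt_of_ne hij with h | h
    · exact hylt i j h
    · obtain ⟨h1, h2⟩ := hylt j i h
      exact ⟨h1.symm, fun u hu w hw => (h2 w hw u hu).symm⟩
  have hyD : ∀ i, ∀ u ∈ g i, ∀ w ∈ D, p u + y i ≠ p w := by
    intro i u hu w hw h
    rw [hbc, Sym2.mem_iff] at hu
    rcases hu with rfl | rfl
    · exact (hyL i).2.2.1 w hw (by linarith)
    · exact (hyL i).2.2.2 w hw (by linarith)
  set f' : Sym2 V → ℝ := fun e => if h : e ∈ M then y (φ ⟨e, h⟩) else f e with hf'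
  have hf'g : ∀ i, f' (g i) = y i := by
    intro i
    simp only [hf']
    rw [dif_pos (hgM i)]
    congr 1
    exact φ.apply_symm_apply i
  have hf'T : ∀ e ∈ T, f' e = f e := fun e he => dif_neg fun h => disjoint_left.1 hMT h he
  have hgsurj : ∀ e ∈ M, ∃ i, g i = e := fun e he => ⟨φ ⟨e, he⟩, by simp [hg]⟩
  have hsum : ∀ u, partialSum ω (T ∪ M) f' u = p u + ∑ e ∈ M with u ∈ e, f' e := by
    intro u
    simp only [hp, partialSum]
    rw [filter_union, sum_union (disjoint_filter_filter hMT.symm), add_assoc]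
    congr 2
    exact sum_congr rfl fun e he => hf'T e (mem_filter.1 he).1
  have hsumg : ∀ i, ∀ u ∈ g i, partialSum ω (T ∪ M) f' u = p u + y i := by
    intro i u hu
    have : ({e ∈ M | u ∈ e} : Finset (Sym2 V)) = {g i} := by
      ext e
      simp only [mem_filter, mem_singleton]
      constructor
      · rintro ⟨h1, h2⟩
        exact hM _ h1 _ (hgM i) u h2 hu
      · rintro rfl
        exact ⟨hgM i, hu⟩
    rw [hsum, this, sum_singleton, hf'g]
  have hsum0 : ∀ u, (∀ e ∈ M, u ∉ e) → partialSum ω (T ∪ M) f' u = p u := by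
    intro u hu
    rw [hsum, filter_false_of_mem hu, sum_empty, add_zero]
  have hsat : ∀ u, (∀ e ∈ M, u ∉ e) → IsSaturated E (T ∪ M) u → u ∈ D := by
    intro u hu h
    simp only [hD, mem_filter, mem_univ, true_and]
    refine ⟨h.1, fun e he hue => ?_⟩
    rcases mem_union.1 (h.2 e he hue) with h' | h'
    · exact h'
    · exact absurd hue (hu e h')
  refine ⟨f', ?_, ?_, ?_⟩
  · intro e he
    rcases mem_union.1 he with he | he
    · rw [hf'T e he]
      exact hf.mem_list e he
    · obtain ⟨i, rfl⟩ := hgsurj e he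
      rw [hf'g]
      exact (hyL i).1
  · intro e₁ h₁ e₂ h₂ h
    rcases mem_union.1 (mem_coe.1 h₁) with h₁ | h₁ <;>
      rcases mem_union.1 (mem_coe.1 h₂) with h₂ | h₂
    · rw [hf'T _ h₁, hf'T _ h₂] at h
      exact hf.injOn h₁ h₂ h
    · obtain ⟨i, rfl⟩ := hgsurj _ h₂
      rw [hf'T _ h₁, hf'g] at h
      exact absurd h ((hyL i).2.1 _ h₁)
    · obtain ⟨i, rfl⟩ := hgsurj _ h₁
      rw [hf'T _ h₂, hf'g] at h
      exact absurd h.symm ((hyL i).2.1 _ h₂)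
    · obtain ⟨i, rfl⟩ := hgsurj _ h₁
      obtain ⟨j, rfl⟩ := hgsurj _ h₂
      rw [hf'g, hf'g] at h
      by_contra hne
      exact (hyij i j fun h0 => hne (h0 ▸ rfl)).1 h
  · rintro u w huw (⟨hu, hw, hK⟩ | ⟨h, -⟩)
    swap
    · simp at h
    by_cases hu' : ∃ e ∈ M, u ∈ e <;> by_cases hw' : ∃ e ∈ M, w ∈ e
    · obtain ⟨e₁, he₁, hu'⟩ := hu'
      obtain ⟨e₂, he₂, hw'⟩ := hw'
      obtain ⟨i, rfl⟩ := hgsurj _ he₁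
      obtain ⟨j, rfl⟩ := hgsurj _ he₂
      rw [hsumg i u hu', hsumg j w hw']
      by_cases hij : i = j
      · subst hij
        have hgi : g i = s(u, w) := (Sym2.mem_and_mem_iff huw).1 ⟨hu', hw'⟩
        have := hf.sum_ne u w huw (Or.inr ⟨hgi ▸ hgM i, by
          by_contra! hcon
          apply hK
          have hmem : ∀ e ∈ E, ∀ z, z ∈ e → z ∈ g i → IsSaturated E (T ∪ M) z →
              (z ∈ e → e ∉ T) → e = s(u, w) := by
            intro e he z hz hzi hsz heT
            rcases mem_union.1 (hsz.2 e he hz) with h | h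
            · exact absurd h (heT hz)
            · rw [← hgi]
              exact hM _ h _ (hgM i) z hz hzi
          rintro e he (h | h)
          · exact hmem e he u h hu' hu fun h1 h2 => (hcon e h2).1 h1
          · exact hmem e he w h hw' hw fun h1 h2 => (hcon e h2).2 h1⟩)
        exact fun h => this (by simpa using h)
      · exact (hyij i j hij).2 u hu' w hw'
    · obtain ⟨e₁, he₁, hu'⟩ := hu'
      obtain ⟨i, rfl⟩ := hgsurj _ he₁
      push Not at hw'
      rw [hsumg i u hu', hsum0 w hw']
      exact hyD i u hu' w (hsat w hw' hw)
    · obtain ⟨e₁, he₁, hw'⟩ := hw'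
      obtain ⟨i, rfl⟩ := hgsurj _ he₁
      push Not at hu'
      rw [hsumg i w hw', hsum0 u hu']
      exact (hyD i w hw' u (hsat u hu' hu)).symm
    · push Not at hu' hw'
      rw [hsum0 u hu', hsum0 w hw']
      have h1 := hsat u hu' hu
      have h2 := hsat w hw' hw
      simp only [hD, mem_filter, mem_univ, true_and] at h1 h2
      exact hf.sum_ne u w huw (Or.inl ⟨h1, h2, hK⟩)

open Finset Classical in
/-- The three edges of a claw can be labeled simultaneously. -/
theorem IsPartialLabeling.exists_insert_claw {V : Type*} [Fintype V] [DecidableEq V]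
    {E : Finset (Sym2 V)} {ω : V → ℝ} {L : Sym2 V → Finset ℝ} {T : Finset (Sym2 V)}
    {f : Sym2 V → ℝ} (hf : IsPartialLabeling E ω L ∅ T f) {d a b c : V} (hda : d ≠ a)
    (hdb : d ≠ b) (hdc : d ≠ c) (hab : a ≠ b) (hac : a ≠ c) (hbc : b ≠ c)
    (ha : s(d, a) ∉ T) (hb : s(d, b) ∉ T) (hc : s(d, c) ∉ T) (l : ℕ) (hl : 8 ≤ l)
    (hl' : #{v | IsSaturated E T v} + 21 ≤ 3 * l)
    (hLa : #T + #{v | IsSaturated E T v} + l ≤ #(L s(d, a)))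
    (hLb : #T + #{v | IsSaturated E T v} + l ≤ #(L s(d, b)))
    (hLc : #T + #{v | IsSaturated E T v} + l ≤ #(L s(d, c))) :
    ∃ f', IsPartialLabeling E ω L ∅ (insert s(d, c) (insert s(d, b) (insert s(d, a) T))) f' := by
  set D : Finset V := {v | IsSaturated E T v} with hD
  set p : V → ℝ := partialSum ω T f with hp
  have hcard : ∀ (K : Finset ℝ) (z : V), #T + #D + l ≤ #K →
      l ≤ #(K \ (T.image f ∪ D.image (fun u => p u - p z))) := by
    intro K z hK
    have h1 := card_union_le (T.image f) (D.image (fun u => p u - p z))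
    have h2 : #(T.image f) ≤ #T := card_image_le
    have h3 : #(D.image (fun u => p u - p z)) ≤ #D := card_image_le
    have h4 := le_card_sdiff (T.image f ∪ D.image (fun u => p u - p z)) K
    omega
  have h3 : ∀ x y z : ℝ, #{x, y, z} ≤ 3 := fun _ _ _ => card_le_three
  have hsym : ∀ (α β γ : V) (x y : ℝ),
      y ∈ ({x, p α + x - p β, p γ - p d - x} : Finset ℝ) ↔
        x ∈ ({y, p β + y - p α, p γ - p d - y} : Finset ℝ) := by
    intro α β γ x y
    simp only [mem_insert, mem_singleton]
    constructor
    · rintro (h | h | h)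
      · exact Or.inl h.symm
      · exact Or.inr (Or.inl (by linarith))
      · exact Or.inr (Or.inr (by linarith))
    · rintro (h | h | h)
      · exact Or.inl h.symm
      · exact Or.inr (Or.inl (by linarith))
      · exact Or.inr (Or.inr (by linarith))
  obtain ⟨x, hx, y, hy, z, hz, hxy, hxz, hyz, hsum⟩ := exists_triple_sum_notMem
    (L s(d, a) \ (T.image f ∪ D.image (fun u => p u - p a)))
    (L s(d, b) \ (T.image f ∪ D.image (fun u => p u - p b)))
    (L s(d, c) \ (T.image f ∪ D.image (fun u => p u - p c)))
    (D.image (fun u => p u - p d)) l (hcard _ _ hLa) (hcard _ _ hLb) (hcard _ _ hLc) hl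
    (le_trans (Nat.add_le_add_right card_image_le 21) hl')
    (fun x => {x, p a + x - p b, p c - p d - x}) (fun x => {x, p a + x - p c, p b - p d - x})
    (fun y => {y, p b + y - p c, p a - p d - y}) (fun y => {y, p b + y - p a, p c - p d - y})
    (fun z => {z, p c + z - p a, p b - p d - z}) (fun z => {z, p c + z - p b, p a - p d - z})
    (fun _ => h3 _ _ _) (fun _ => h3 _ _ _) (fun _ => h3 _ _ _) (fun _ => h3 _ _ _)
    (fun _ => h3 _ _ _) (fun _ => h3 _ _ _) (fun x y => hsym a b c x y)
    (fun x z => hsym a c b x z) (fun y z => hsym b c a y z)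
  simp only [mem_insert, mem_singleton, mem_sdiff, mem_union, mem_image, not_or, not_exists,
    not_and] at hx hy hz hxy hxz hyz hsum
  have eab : s(d, a) ≠ s(d, b) := fun h => hab (Sym2.congr_right.1 h)
  have eac : s(d, a) ≠ s(d, c) := fun h => hac (Sym2.congr_right.1 h)
  have ebc : s(d, b) ≠ s(d, c) := fun h => hbc (Sym2.congr_right.1 h)
  have hb' : s(d, b) ∉ insert s(d, a) T := by simp [hb, eab.symm, -Sym2.eq]
  have hc' : s(d, c) ∉ insert s(d, b) (insert s(d, a) T) := by
    simp [hc, eac.symm, ebc.symm, -Sym2.eq]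
  set T' := insert s(d, c) (insert s(d, b) (insert s(d, a) T)) with hT'
  set f' := Function.update (Function.update (Function.update f s(d, a) x) s(d, b) y) s(d, c) z
    with hf'
  have fa : f' s(d, a) = x := by
    rw [hf', Function.update_of_ne eac, Function.update_of_ne eab, Function.update_self]
  have fb : f' s(d, b) = y := by
    rw [hf', Function.update_of_ne ebc, Function.update_self]
  have fc : f' s(d, c) = z := Function.update_self ..
  have fT : ∀ e ∈ T, f' e = f e := by
    intro e he
    rw [hf', Function.update_of_ne, Function.update_of_ne, Function.update_of_ne] <;>
    · rintro rfl
      contradiction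
  have hP : ∀ u, partialSum ω T' f' u = p u + (if u ∈ s(d, a) then x else 0) +
      (if u ∈ s(d, b) then y else 0) + (if u ∈ s(d, c) then z else 0) := by
    intro u
    rw [hT', hf', partialSum_insert_update ω _ hc', partialSum_insert_update ω _ hb',
      partialSum_insert_update ω _ ha]
  have Pa : partialSum ω T' f' a = p a + x := by simp [hP, hda.symm, hab, hac]
  have Pb : partialSum ω T' f' b = p b + y := by simp [hP, hdb.symm, hab.symm, hbc]
  have Pc : partialSum ω T' f' c = p c + z := by simp [hP, hdc.symm, hac.symm, hbc.symm]
  have Pd : partialSum ω T' f' d = p d + (x + y + z) := by simp [hP]; ring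
  have hcases : ∀ u, IsSaturated E T' u →
      (u ∈ D ∧ partialSum ω T' f' u = p u) ∨ u = a ∨ u = b ∨ u = c ∨ u = d := by
    intro u hu
    by_cases h : u = a ∨ u = b ∨ u = c ∨ u = d
    · exact Or.inr h
    · push Not at h
      obtain ⟨h1, h2, h3, h4⟩ := h
      have ha' : u ∉ s(d, a) := by simp [h1, h4]
      have hb' : u ∉ s(d, b) := by simp [h2, h4]
      have hc' : u ∉ s(d, c) := by simp [h3, h4]
      refine Or.inl ⟨?_, by simp only [hP, if_neg ha', if_neg hb', if_neg hc', add_zero]⟩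
      simp only [hD, mem_filter, mem_univ, true_and]
      exact ((hu.of_insert hc').of_insert hb').of_insert ha'
  have Qa : ∀ u ∈ D, p u ≠ p a + x := fun u hu h => hx.2.2 u hu (by linarith)
  have Qb : ∀ u ∈ D, p u ≠ p b + y := fun u hu h => hy.2.2 u hu (by linarith)
  have Qc : ∀ u ∈ D, p u ≠ p c + z := fun u hu h => hz.2.2 u hu (by linarith)
  have Qd : ∀ u ∈ D, p u ≠ p d + (x + y + z) := fun u hu h => hsum u hu (by linarith)
  have Qab : p a + x ≠ p b + y := fun h => hxy.2.1 (by linarith)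
  have Qac : p a + x ≠ p c + z := fun h => hxz.2.1 (by linarith)
  have Qbc : p b + y ≠ p c + z := fun h => hyz.2.1 (by linarith)
  have Qad : p a + x ≠ p d + (x + y + z) := fun h => hyz.2.2 (by linarith)
  have Qbd : p b + y ≠ p d + (x + y + z) := fun h => hxz.2.2 (by linarith)
  have Qcd : p c + z ≠ p d + (x + y + z) := fun h => hxy.2.2 (by linarith)
  refine ⟨f', ?_, ?_, ?_⟩
  · intro e he
    simp only [hT', mem_insert] at he
    rcases he with rfl | rfl | rfl | he
    · rw [fc]; exact hz.1
    · rw [fb]; exact hy.1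
    · rw [fa]; exact hx.1
    · rw [fT e he]; exact hf.mem_list e he
  · intro e₁ h₁ e₂ h₂ h
    simp only [hT', coe_insert, Set.mem_insert_iff, mem_coe] at h₁ h₂
    have hxT := hx.2.1
    have hyT := hy.2.1
    have hzT := hz.2.1
    rcases h₁ with rfl | rfl | rfl | h₁ <;> rcases h₂ with rfl | rfl | rfl | h₂
    all_goals try simp only [fa, fb, fc] at h
    all_goals try rw [fT _ h₁] at h
    all_goals try rw [fT _ h₂] at h
    all_goals first
      | rfl
      | exact hf.injOn h₁ h₂ h
      | (exfalso; grind)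
  · rintro u w huw (⟨hu, hw, hK⟩ | ⟨h, -⟩)
    swap
    · simp at h
    rcases hcases u hu with ⟨hu', hPu⟩ | rfl | rfl | rfl | rfl <;>
      rcases hcases w hw with ⟨hw', hPw⟩ | rfl | rfl | rfl | rfl
    · rw [hPu, hPw]
      simp only [hD, mem_filter, mem_univ, true_and] at hu' hw'
      exact hf.sum_ne u w huw (Or.inl ⟨hu', hw', hK⟩)
    all_goals grind

open Finset Classical in
/-- A set of edges that is a union of components with maximum degree at most two contains a
maximal matching with at least as many edges as there are unmatched vertices. -/
theorem exists_isEdgeMatching_of_degree_le_two {V : Type*} [Fintype V] [DecidableEq V]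
    {A : Finset (Sym2 V)} (hdeg : ∀ v, #{e ∈ A | v ∈ e} ≤ 2) :
    ∃ M ⊆ A, IsEdgeMatching M ∧ (∀ e ∈ A, ∃ e' ∈ M, ∃ v, v ∈ e ∧ v ∈ e') ∧
      #{u | (∃ e ∈ A, u ∈ e) ∧ ∀ e ∈ M, u ∉ e} ≤ #M := by
  obtain ⟨M, hM, hmax⟩ := exists_max_image (A.powerset.filter IsEdgeMatching) card
    ⟨∅, by simp [IsEdgeMatching]⟩
  simp only [mem_filter, mem_powerset] at hM hmax
  obtain ⟨hMA, hM⟩ := hM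
  have hmeet : ∀ e ∈ A, ∃ e' ∈ M, ∃ v, v ∈ e ∧ v ∈ e' := by
    intro e he
    by_contra! hcon
    have heM : e ∉ M := by
      intro h
      induction e using Sym2.ind with
      | _ a b => exact hcon _ h a (Sym2.mem_mk_left _ _) (Sym2.mem_mk_left _ _)
    have := hmax (insert e M) ⟨insert_subset he hMA, by
      intro e₁ h₁ e₂ h₂ v hv₁ hv₂
      rcases mem_insert.1 h₁ with rfl | h₁' <;> rcases mem_insert.1 h₂ with rfl | h₂'
      · rfl
      · exact absurd hv₂ (hcon _ h₂' v hv₁)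
      · exact absurd hv₁ (hcon _ h₁' v hv₂)
      · exact hM _ h₁' _ h₂' v hv₁ hv₂⟩
    rw [card_insert_of_notMem heM] at this
    omega
  refine ⟨M, hMA, hM, hmeet, ?_⟩
  set U : Finset V := {u | (∃ e ∈ A, u ∈ e) ∧ ∀ e ∈ M, u ∉ e} with hU
  have hchoice : ∀ u ∈ U, ∃ b, ∃ e ∈ M, s(u, b) ∈ A ∧ b ∈ e := by
    intro u hu
    simp only [hU, mem_filter, mem_univ, true_and] at hu
    obtain ⟨⟨e, he, hue⟩, huM⟩ := hu
    obtain ⟨b, rfl⟩ := Sym2.mem_iff_exists.1 hue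
    obtain ⟨e', he', v, hv, hv'⟩ := hmeet _ he
    rcases Sym2.mem_iff.1 hv with rfl | rfl
    · exact absurd hv' (huM _ he')
    · exact ⟨v, e', he', he, hv'⟩
  obtain hU0 | ⟨u₀, -⟩ := U.eq_empty_or_nonempty
  · simp [hU0]
  have : Nonempty V := ⟨u₀⟩
  have : Nonempty (Sym2 V) := ⟨s(u₀, u₀)⟩
  choose! b g hgM hbA hbg using hchoice
  refine card_le_card_of_injOn g hgM ?_
  intro u hu u' hu' hgg
  by_contra hne
  have hu := mem_coe.1 hu
  have hu' := mem_coe.1 hu'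
  have huM : ∀ e ∈ M, u ∉ e := (mem_filter.1 hu).2.2
  have hu'M : ∀ e ∈ M, u' ∉ e := (mem_filter.1 hu').2.2
  have hb'g : b u' ∈ g u := hgg ▸ hbg u' hu'
  have hn1 : s(u, b u) ≠ g u := fun h => huM _ (hgM u hu) (h ▸ Sym2.mem_mk_left _ _)
  have hn2 : s(u', b u') ≠ g u := fun h => hu'M _ (hgM u hu) (h ▸ Sym2.mem_mk_left _ _)
  by_cases hbb : b u = b u'
  · have hn3 : s(u, b u) ≠ s(u', b u') := by
      rw [hbb]
      exact fun h => hne (Sym2.congr_left.1 h)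
    have h3 : #{s(u, b u), s(u', b u'), g u} = 3 := card_eq_three.2 ⟨_, _, _, hn3, hn1, hn2, rfl⟩
    have hsub : ({s(u, b u), s(u', b u'), g u} : Finset (Sym2 V)) ⊆ {e ∈ A | b u ∈ e} := by
      intro e he
      simp only [mem_insert, mem_singleton] at he
      rw [mem_filter]
      rcases he with rfl | rfl | rfl
      · exact ⟨hbA u hu, Sym2.mem_mk_right _ _⟩
      · exact ⟨hbA u' hu', hbb ▸ Sym2.mem_mk_right _ _⟩
      · exact ⟨hMA (hgM u hu), hbg u hu⟩
    have h4 := card_le_card hsub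
    have h5 := hdeg (b u)
    omega
  · have hgu : g u = s(b u, b u') := (Sym2.mem_and_mem_iff hbb).1 ⟨hbg u hu, hb'g⟩
    have hbM : b u ≠ u' := fun h => hu'M _ (hgM u hu) (h ▸ hbg u hu)
    have hbM' : b u' ≠ u := fun h => huM _ (hgM u hu) (h ▸ hb'g)
    have hdis : ∀ v, v ∈ s(u, b u) → v ∈ s(u', b u') → False := by
      intro v h1 h2
      rw [Sym2.mem_iff] at h1 h2
      grind
    have hother : ∀ e ∈ M.erase (g u), ∀ v, v ∈ e → v ∉ s(u, b u) ∧ v ∉ s(u', b u') := by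
      intro e he v hv
      obtain ⟨h1, h2⟩ := mem_erase.1 he
      constructor <;> intro h <;> rcases Sym2.mem_iff.1 h with rfl | rfl
      · exact huM _ h2 hv
      · exact h1 (hM _ h2 _ (hgM u hu) _ hv (hbg u hu))
      · exact hu'M _ h2 hv
      · exact h1 (hM _ h2 _ (hgM u hu) _ hv hb'g)
    have hn3 : s(u, b u) ≠ s(u', b u') := fun h =>
      hdis u (Sym2.mem_mk_left _ _) (h ▸ Sym2.mem_mk_left _ _)
    have hn4 : s(u', b u') ∉ M.erase (g u) := fun h =>
      (hother _ h _ (Sym2.mem_mk_left _ _)).2 (Sym2.mem_mk_left _ _)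
    have hn5 : s(u, b u) ∉ insert s(u', b u') (M.erase (g u)) := fun h => by
      rcases mem_insert.1 h with h | h
      · exact hn3 h
      · exact (hother _ h _ (Sym2.mem_mk_left _ _)).1 (Sym2.mem_mk_left _ _)
    have := hmax (insert s(u, b u) (insert s(u', b u') (M.erase (g u)))) ⟨by
      intro e he
      simp only [mem_insert] at he
      rcases he with rfl | rfl | he
      · exact hbA u hu
      · exact hbA u' hu'
      · exact hMA (mem_of_mem_erase he), by
      intro e₁ h₁ e₂ h₂ v hv₁ hv₂
      simp only [mem_insert] at h₁ h₂
      rcases h₁ with rfl | rfl | h₁ <;> rcases h₂ with rfl | rfl | h₂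
      · rfl
      · exact (hdis v hv₁ hv₂).elim
      · exact absurd hv₁ (hother _ h₂ v hv₂).1
      · exact (hdis v hv₂ hv₁).elim
      · rfl
      · exact absurd hv₁ (hother _ h₂ v hv₂).2
      · exact absurd hv₂ (hother _ h₁ v hv₁).1
      · exact absurd hv₂ (hother _ h₁ v hv₁).2
      · exact hM _ (mem_of_mem_erase h₁) _ (mem_of_mem_erase h₂) v hv₁ hv₂⟩
    rw [card_insert_of_notMem hn5, card_insert_of_notMem hn4,
      card_erase_of_mem (hgM u hu)] at this
    have : 0 < #M := card_pos.2 ⟨_, hgM u hu⟩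
    omega

open Finset Classical in
/-- A union of components with maximum degree at most two can be labeled from the given lists. -/
theorem exists_isPartialLabeling_of_degree_le_two {V : Type*} [Fintype V] [DecidableEq V]
    {E : Finset (Sym2 V)} (hE : ∀ e ∈ E, ¬e.IsDiag) (ω : V → ℝ) {L : Sym2 V → Finset ℝ}
    (hL : ∀ e ∈ E, #E + 4 * Fintype.card V / 3 ≤ #(L e)) {A : Finset (Sym2 V)} (hAE : A ⊆ E)
    (hdeg : ∀ v, #{e ∈ A | v ∈ e} ≤ 2) :
    ∃ f, IsPartialLabeling E ω L ∅ A f := by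
  obtain ⟨M, hMA, hM, hmeet, hcard⟩ :=
    exists_isEdgeMatching_of_degree_le_two hdeg
  have h0 : IsPartialLabeling E ω L M ∅ 0 := by
    refine ⟨by simp, by simp, ?_⟩
    rintro u w - (⟨⟨⟨e, he, hue⟩, h⟩, -⟩ | ⟨-, e, he, -⟩)
    · exact absurd (h e he hue) (notMem_empty _)
    · exact absurd he (notMem_empty _)
  have hdisj : Disjoint M (A \ M) := disjoint_sdiff
  obtain ⟨f, hf⟩ := h0.exists_of_rank hE
    (fun e he => by have := hL e he; omega) hM
    (fun v => if ∃ e ∈ M, v ∈ e then 0 else 1) (A \ M) (empty_subset _)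
    (sdiff_subset.trans hAE) hdisj (by
      intro e he v hv
      simp only [mem_sdiff, notMem_empty, not_false_eq_true, and_true] at he
      by_cases hvM : ∃ e ∈ M, v ∈ e
      · obtain ⟨e', he', hv'⟩ := hvM
        obtain ⟨w, rfl⟩ := Sym2.mem_iff_exists.1 hv'
        exact ⟨w, hAE (hMA he'), notMem_empty _, Or.inl fun h => (mem_sdiff.1 h).2 he'⟩
      · obtain ⟨w, rfl⟩ := Sym2.mem_iff_exists.1 hv
        obtain ⟨e', he', z, hz, hz'⟩ := hmeet _ he.1
        have hzw : z = w := by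
          rcases Sym2.mem_iff.1 hz with rfl | rfl
          · exact absurd ⟨e', he', hz'⟩ hvM
          · rfl
        subst hzw
        refine ⟨z, hAE he.1, notMem_empty _, Or.inr ?_⟩
        rw [if_pos ⟨e', he', hz'⟩, if_neg hvM]
        exact one_pos)
  set D : Finset V := {v | IsSaturated E (A \ M) v} with hD
  have hDM : ∀ v ∈ D, ∀ e ∈ M, v ∉ e := by
    intro v hv e he hve
    have hv := (mem_filter.1 hv).2
    exact (mem_sdiff.1 (hv.2 e (hAE (hMA he)) hve)).2 he
  have hDcard : #D ≤ #M := by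
    refine (card_le_card fun v hv => ?_).trans hcard
    rw [mem_filter]
    refine ⟨mem_univ _, ?_, hDM v hv⟩
    obtain ⟨⟨e, he, hve⟩, h⟩ := (mem_filter.1 hv).2
    exact ⟨e, (mem_sdiff.1 (h e he hve)).1, hve⟩
  have hVcard : #D + 2 * #M ≤ Fintype.card V := by
    have h1 : #(M.biUnion Sym2.toFinset) = 2 * #M := by
      rw [card_biUnion, mul_comm]
      · refine sum_const_nat fun e he => ?_
        exact Sym2.card_toFinset_of_not_isDiag _ (hE e (hAE (hMA he)))
      · intro e he e' he' hne
        rw [Function.onFun, disjoint_left]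
        intro v hv hv'
        exact hne (hM e he e' he' v (Sym2.mem_toFinset.1 hv) (Sym2.mem_toFinset.1 hv'))
    have h2 : Disjoint D (M.biUnion Sym2.toFinset) := by
      rw [disjoint_left]
      intro v hv hv'
      obtain ⟨e, he, hve⟩ := mem_biUnion.1 hv'
      exact hDM v hv e he (Sym2.mem_toFinset.1 hve)
    rw [← h1, ← card_union_of_disjoint h2]
    exact card_le_univ _
  obtain ⟨f', hf'⟩ := hf.exists_union_matching hM hdisj (by
    intro e he
    have h1 := hL e (hAE (hMA he))
    have h2 := card_sdiff_add_card_eq_card hMA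
    have h3 := card_le_card hAE
    have h4 : 0 < #M := card_pos.2 ⟨e, he⟩
    rw [← hD]
    omega)
  exact ⟨f', by rwa [sdiff_union_of_subset hMA] at hf'⟩

open Finset Classical in
/-- The edges of vertex-disjoint claws can be labeled after all other edges. -/
theorem IsPartialLabeling.exists_union_claws {V : Type*} [Fintype V] [DecidableEq V]
    {E : Finset (Sym2 V)} {ω : V → ℝ} {L : Sym2 V → Finset ℝ}
    (hL : ∀ e ∈ E, #E + 4 * Fintype.card V / 3 ≤ #(L e)) {T : Finset (Sym2 V)} {f : Sym2 V → ℝ}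
    (hf : IsPartialLabeling E ω L ∅ T f) (hTE : T ⊆ E) {a b c : V → V} {P : Finset V}
    (ha : ∀ d ∈ P, a d ∉ P ∧ s(d, a d) ∈ E \ T) (hb : ∀ d ∈ P, b d ∉ P ∧ s(d, b d) ∈ E \ T)
    (hc : ∀ d ∈ P, c d ∉ P ∧ s(d, c d) ∈ E \ T)
    (habc : ∀ d ∈ P, a d ≠ b d ∧ a d ≠ c d ∧ b d ≠ c d) :
    ∃ f', IsPartialLabeling E ω L ∅
      (T ∪ P.biUnion fun d => {s(d, c d), s(d, b d), s(d, a d)}) f' := by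
  suffices h : ∀ Q ⊆ P, ∃ f', IsPartialLabeling E ω L ∅
      (T ∪ Q.biUnion fun d => {s(d, c d), s(d, b d), s(d, a d)}) f' from h P Subset.rfl
  intro Q
  induction Q using Finset.induction_on with
  | empty => exact fun _ => ⟨f, by simpa using hf⟩
  | insert d Q hdQ ih =>
    intro hQP
    obtain ⟨hdP, hQP⟩ := insert_subset_iff.1 hQP
    obtain ⟨f', hf'⟩ := ih hQP
    set T' := T ∪ Q.biUnion fun d => {s(d, c d), s(d, b d), s(d, a d)} with hT'
    have hT'E : T' ⊆ E := by
      refine union_subset hTE (biUnion_subset.2 fun q hq e he => ?_)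
      simp only [mem_insert, mem_singleton] at he
      rcases he with rfl | rfl | rfl
      exacts [(mem_sdiff.1 (hc q (hQP hq)).2).1, (mem_sdiff.1 (hb q (hQP hq)).2).1,
        (mem_sdiff.1 (ha q (hQP hq)).2).1]
    have hnotMem : ∀ x, s(d, x) ∉ T → s(d, x) ∉ T' := by
      intro x hx h
      rcases mem_union.1 h with h | h
      · exact hx h
      · obtain ⟨q, hq, h⟩ := mem_biUnion.1 h
        have hd : ∀ y, y ∉ P → s(d, x) ≠ s(q, y) := by
          intro y hy h
          have : d ∈ s(q, y) := h ▸ Sym2.mem_mk_left _ _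
          rcases Sym2.mem_iff.1 this with rfl | rfl
          · exact hdQ hq
          · exact hy hdP
        simp only [mem_insert, mem_singleton] at h
        rcases h with h | h | h
        exacts [hd _ (hc q (hQP hq)).1 h, hd _ (hb q (hQP hq)).1 h, hd _ (ha q (hQP hq)).1 h]
    obtain ⟨haP, haE⟩ := ha d hdP
    obtain ⟨hbP, hbE⟩ := hb d hdP
    obtain ⟨hcP, hcE⟩ := hc d hdP
    obtain ⟨hab, hac, hbc⟩ := habc d hdP
    rw [mem_sdiff] at haE hbE hcE
    have hne : ∀ x, x ∉ P → d ≠ x := fun x hx h => hx (h ▸ hdP)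
    have haT := hnotMem _ haE.2
    have hbT := hnotMem _ hbE.2
    have hcT := hnotMem _ hcE.2
    have hcardT : #T' + 3 ≤ #E := by
      have h3 : #{s(d, a d), s(d, b d), s(d, c d)} = 3 := by
        refine card_eq_three.2 ⟨_, _, _, ?_, ?_, ?_, rfl⟩ <;>
          rwa [Ne, Sym2.congr_right]
      have hdis : Disjoint T' {s(d, a d), s(d, b d), s(d, c d)} := by
        rw [disjoint_right]
        intro e he
        simp only [mem_insert, mem_singleton] at he
        rcases he with rfl | rfl | rfl <;> assumption
      rw [← h3, ← card_union_of_disjoint hdis]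
      refine card_le_card (union_subset hT'E fun e he => ?_)
      simp only [mem_insert, mem_singleton] at he
      rcases he with rfl | rfl | rfl
      exacts [haE.1, hbE.1, hcE.1]
    have hcardV : #{v | IsSaturated E T' v} + 4 ≤ Fintype.card V := by
      have h4 : #{d, a d, b d, c d} = 4 := by
        rw [card_insert_of_notMem, card_eq_three.2 ⟨_, _, _, hab, hac, hbc, rfl⟩]
        simp [hne _ haP, hne _ hbP, hne _ hcP]
      have hdis : Disjoint ({v | IsSaturated E T' v} : Finset V) {d, a d, b d, c d} := by
        rw [disjoint_right]
        intro v hv h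
        simp only [mem_insert, mem_singleton] at hv
        have h := (mem_filter.1 h).2.2
        rcases hv with rfl | rfl | rfl | rfl
        · exact haT (h _ haE.1 (Sym2.mem_mk_left _ _))
        · exact haT (h _ haE.1 (Sym2.mem_mk_right _ _))
        · exact hbT (h _ hbE.1 (Sym2.mem_mk_right _ _))
        · exact hcT (h _ hcE.1 (Sym2.mem_mk_right _ _))
      rw [← h4, ← card_union_of_disjoint hdis]
      exact card_le_univ _
    have hLa := hL _ haE.1
    have hLb := hL _ hbE.1
    have hLc := hL _ hcE.1
    obtain ⟨f'', hf''⟩ := hf'.exists_insert_claw (hne _ haP) (hne _ hbP) (hne _ hcP) hab hac hbc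
      haT hbT hcT (Fintype.card V / 3 + 7) (by omega) (by omega) (by omega) (by omega) (by omega)
    refine ⟨f'', ?_⟩
    convert hf'' using 1
    ext e
    simp only [hT', biUnion_insert, mem_union, mem_insert, mem_singleton]
    tauto

open Finset Classical in
/-- All edges of a graph can be labeled from the given lists. -/
theorem exists_isPartialLabeling_edgeFinset {V : Type*} [Fintype V] [DecidableEq V]
    (G : SimpleGraph V) [DecidableRel G.Adj] (ω : V → ℝ) {L : Sym2 V → Finset ℝ}
    (hL : ∀ e ∈ G.edgeFinset, #G.edgeFinset + 4 * Fintype.card V / 3 ≤ #(L e)) :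
    ∃ f, IsPartialLabeling G.edgeFinset ω L ∅ G.edgeFinset f := by
  set E := G.edgeFinset with hEdef
  have hE : ∀ e ∈ E, ¬e.IsDiag := fun e he =>
    G.not_isDiag_of_mem_edgeSet (by simpa [hEdef] using he)
  have hadj : ∀ {v w}, s(v, w) ∈ E ↔ G.Adj v w := by simp [hEdef]
  set big : V → Prop := fun v => ∃ d, G.Reachable v d ∧ 3 ≤ G.degree d with hbig
  have hbig_adj : ∀ {v w}, G.Adj v w → (big v ↔ big w) := by
    intro v w h
    exact ⟨fun ⟨d, hd, h3⟩ => ⟨d, h.reachable.symm.trans hd, h3⟩,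
      fun ⟨d, hd, h3⟩ => ⟨d, h.reachable.trans hd, h3⟩⟩
  obtain ⟨ctr, hctr, hctr_adj⟩ : ∃ ctr : V → V,
      (∀ v, big v → G.Reachable v (ctr v) ∧ 3 ≤ G.degree (ctr v)) ∧
      ∀ v w, G.Reachable v w → ctr v = ctr w := by
    have hex : ∀ κ : G.ConnectedComponent, ∃ d, ∀ v, G.connectedComponentMk v = κ → big v →
        G.Reachable v d ∧ 3 ≤ G.degree d := by
      intro κ
      induction κ using SimpleGraph.ConnectedComponent.ind with
      | _ u =>
        by_cases hu : big u
        · obtain ⟨d, hd, h3⟩ := hu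
          exact ⟨d, fun v hv _ => ⟨(SimpleGraph.ConnectedComponent.exact hv).trans hd, h3⟩⟩
        · refine ⟨u, fun v hv ⟨d, hd, h3⟩ => absurd ⟨d, ?_, h3⟩ hu⟩
          exact (SimpleGraph.ConnectedComponent.exact hv).symm.trans hd
    choose c hc using hex
    exact ⟨fun v => c (G.connectedComponentMk v), fun v hv => hc _ v rfl hv,
      fun v w h => congrArg c (SimpleGraph.ConnectedComponent.sound h)⟩
  have hleaves : ∀ d, ∃ a b c, 3 ≤ G.degree d →
      G.Adj d a ∧ G.Adj d b ∧ G.Adj d c ∧ a ≠ b ∧ a ≠ c ∧ b ≠ c := by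
    intro d
    by_cases h : 3 ≤ G.degree d
    · obtain ⟨a, ha, b, hb, c, hc, h'⟩ := two_lt_card.1 h
      simp only [SimpleGraph.mem_neighborFinset] at ha hb hc
      exact ⟨a, b, c, fun _ => ⟨ha, hb, hc, h'⟩⟩
    · exact ⟨d, d, d, fun h' => absurd h' h⟩
  choose a b c habc using hleaves
  set P : Finset V := {d | big d ∧ ctr d = d} with hP
  have hPdeg : ∀ d ∈ P, 3 ≤ G.degree d := by
    intro d hd
    obtain ⟨h1, h2⟩ := (mem_filter.1 hd).2
    exact h2 ▸ (hctr d h1).2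
  have hPadj : ∀ d ∈ P, ∀ x, G.Adj d x → x ∉ P := by
    intro d hd x hx hxP
    have h1 := (mem_filter.1 hd).2.2
    have h2 := (mem_filter.1 hxP).2.2
    have h3 := hctr_adj d x hx.reachable
    exact hx.ne (by rw [← h1, ← h2, h3])
  set Cl := P.biUnion fun d => {s(d, c d), s(d, b d), s(d, a d)} with hCl
  have hClP : ∀ e ∈ Cl, ∃ d ∈ P, d ∈ e := by
    intro e he
    obtain ⟨d, hd, he⟩ := mem_biUnion.1 he
    refine ⟨d, hd, ?_⟩
    simp only [mem_insert, mem_singleton] at he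
    rcases he with rfl | rfl | rfl <;> exact Sym2.mem_mk_left _ _
  have hleaf : ∀ {x : V → V}, (∀ d ∈ P, G.Adj d (x d)) →
      (∀ d, s(d, x d) ∈ ({s(d, c d), s(d, b d), s(d, a d)} : Finset (Sym2 V))) →
      ∀ d ∈ P, x d ∉ P ∧ s(d, x d) ∈ E \ (E \ Cl) := by
    intro x hx hxC d hd
    refine ⟨hPadj d hd _ (hx d hd), ?_⟩
    rw [mem_sdiff, mem_sdiff, not_and_not_right]
    exact ⟨hadj.2 (hx d hd), fun _ => mem_biUnion.2 ⟨d, hd, hxC d⟩⟩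
  have hClE : Cl ⊆ E := by
    refine biUnion_subset.2 fun d hd e he => ?_
    obtain ⟨h1, h2, h3, -⟩ := habc d (hPdeg d hd)
    simp only [mem_insert, mem_singleton] at he
    rcases he with rfl | rfl | rfl
    exacts [hadj.2 h3, hadj.2 h2, hadj.2 h1]
  set A : Finset (Sym2 V) := {e ∈ E | ∀ v ∈ e, ¬big v} with hA
  have hAE : A ⊆ E := filter_subset _ _
  have hACl : Disjoint A Cl := by
    rw [disjoint_left]
    intro e heA heC
    obtain ⟨d, hd, hde⟩ := hClP e heC
    exact (mem_filter.1 heA).2 d hde (mem_filter.1 hd).2.1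
  have hdeg : ∀ v, #{e ∈ A | v ∈ e} ≤ 2 := by
    intro v
    by_cases hv : big v
    · have h0 : {e ∈ A | v ∈ e} = ∅ :=
        filter_eq_empty_iff.2 fun {_} he hve => (mem_filter.1 he).2 v hve hv
      simp [h0]
    · have h2 : ¬3 ≤ G.degree v := fun h => hv ⟨v, SimpleGraph.Reachable.refl v, h⟩
      have h1 : #{e ∈ A | v ∈ e} ≤ G.degree v := by
        rw [← G.card_incidenceFinset_eq_degree, G.incidenceFinset_eq_filter]
        exact card_le_card (filter_subset_filter _ hAE)
      omega
  obtain ⟨f, hf⟩ := exists_isPartialLabeling_of_degree_le_two hE ω hL hAE hdeg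
  have hAT : A ⊆ E \ Cl := fun e he => mem_sdiff.2 ⟨hAE he, disjoint_left.1 hACl he⟩
  obtain ⟨f', hf'⟩ := hf.exists_of_rank hE (fun e he => by have := hL e he; omega)
    (by simp [IsEdgeMatching]) (fun v => G.dist v (ctr v)) (E \ Cl) hAT sdiff_subset
    (disjoint_empty_left _) (by
      intro e he v hve
      obtain ⟨w, rfl⟩ := Sym2.mem_iff_exists.1 hve
      obtain ⟨he, heA⟩ := mem_sdiff.1 he
      have hvw := hadj.1 (mem_sdiff.1 he).1
      have hv : big v := by
        by_contra hv
        refine heA (mem_filter.2 ⟨(mem_sdiff.1 he).1, fun x hx => ?_⟩)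
        rcases Sym2.mem_iff.1 hx with rfl | rfl
        · exact hv
        · rwa [← hbig_adj hvw]
      have hnA : ∀ x, s(v, x) ∉ A := fun x hx =>
        (mem_filter.1 hx).2 v (Sym2.mem_mk_left _ _) hv
      by_cases hvc : ctr v = v
      · have hvP : v ∈ P := mem_filter.2 ⟨mem_univ _, hv, hvc⟩
        refine ⟨a v, hadj.2 (habc v (hPdeg v hvP)).1, hnA _, Or.inl fun h => ?_⟩
        refine (mem_sdiff.1 h).2 (mem_biUnion.2 ⟨v, hvP, ?_⟩)
        simp
      · obtain ⟨p, hp⟩ := (hctr v hv).1.exists_walk_length_eq_dist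
        obtain ⟨w', h, q, rfl⟩ := p.exists_eq_cons_of_ne (Ne.symm hvc)
        refine ⟨w', hadj.2 h, hnA _, Or.inr ?_⟩
        rw [← hctr_adj v w' h.reachable, ← hp, SimpleGraph.Walk.length_cons]
        exact Nat.lt_succ_of_le (SimpleGraph.dist_le q))
  obtain ⟨f'', hf''⟩ := hf'.exists_union_claws hL sdiff_subset (a := a) (b := b) (c := c) (P := P)
    (hleaf (fun d hd => (habc d (hPdeg d hd)).1) (by simp))
    (hleaf (fun d hd => (habc d (hPdeg d hd)).2.1) (by simp))
    (hleaf (fun d hd => (habc d (hPdeg d hd)).2.2.1) (by simp))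
    (fun d hd => (habc d (hPdeg d hd)).2.2.2)
  refine ⟨f'', ?_⟩
  rwa [← hCl, sdiff_union_of_subset hClE] at hf''

/-- Every graph on `n` vertices is `⌊4n/3⌋`-list-weighted-quasi-antimagic. -/
theorem statement_2 {V : Type*} [Fintype V] (G : SimpleGraph V) :
    ListWeightedQuasiAntimagic G ((4 * Fintype.card V) / 3) := by
  classical
  intro ω L hL
  have hcard : Nat.card G.edgeSet = G.edgeFinset.card := by
    rw [Nat.card_eq_fintype_card, SimpleGraph.edgeFinset_card]
  rw [hcard] at hL
  obtain ⟨f, hf⟩ := exists_isPartialLabeling_edgeFinset G ω (L := L)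
    fun e he => hL e (SimpleGraph.mem_edgeFinset.1 he)
  have hsum : ∀ v, weightedSum G ω f v = partialSum ω G.edgeFinset f v := by
    intro v
    unfold weightedSum partialSum
    congr 2
    ext e
    simp [SimpleGraph.incidenceSet]
  have hsat : ∀ v, 1 ≤ Nat.card (G.neighborSet v) →
      (∃ w, G.Adj v w) ∧ IsSaturated G.edgeFinset G.edgeFinset v := by
    intro v hv
    obtain ⟨⟨w, hw⟩⟩ := (Nat.card_pos_iff.1 hv).1
    exact ⟨⟨w, hw⟩, ⟨s(v, w), by simpa using hw, Sym2.mem_mk_left _ _⟩, fun _ he _ => he⟩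
  refine ⟨f, fun e he => hf.mem_list e (SimpleGraph.mem_edgeFinset.2 he), ?_, ?_⟩
  · intro e₁ h₁ e₂ h₂ hne h
    exact hne (hf.injOn (by simpa using h₁) (by simpa using h₂) h)
  · intro u w huw hu hw hK
    rw [hsum, hsum]
    refine hf.sum_ne u w huw (Or.inl ⟨(hsat u hu).2, (hsat w hw).2, fun h => hK ?_⟩)
    have hu' : ∀ x, G.Adj u x → x = w := fun x hx =>
      Sym2.congr_right.1 (h s(u, x) (by simpa using hx) (Or.inl (Sym2.mem_mk_left _ _)))
    have hw' : ∀ x, G.Adj w x → x = u := fun x hx =>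
      Sym2.congr_right.1 ((h s(w, x) (by simpa using hx) (Or.inr (Sym2.mem_mk_left _ _))).trans
        Sym2.eq_swap)
    obtain ⟨x, hx⟩ := (hsat u hu).1
    obtain rfl := hu' x hx
    refine ⟨hx, ?_, ?_⟩
    · rw [show G.neighborSet u = {x} from
        Set.eq_singleton_iff_unique_mem.2 ⟨hx, hu'⟩, Nat.card_unique]
    · rw [show G.neighborSet x = {u} from
        Set.eq_singleton_iff_unique_mem.2 ⟨hx.symm, hw'⟩, Nat.card_unique]
end

section
/- If G is a graph on n vertices with maximum degree Δ(G) ≤ 2, then G is ⌊4n/3⌋-list-weighted-quasi-antimagic. -/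
open Finset MvPolynomial

/-- The polynomial `p` is, up to the factor `ε`, invariant under the substitution
`a ↦ D - a` of exponents. -/
def IsReciprocal {σ : Type*} (D : σ →₀ ℕ) (ε : ℝ) (p : MvPolynomial σ ℝ) : Prop :=
  (∀ a, coeff a p ≠ 0 → a ≤ D) ∧ ∀ a b, a + b = D → coeff a p = ε * coeff b p

theorem IsReciprocal.one {σ : Type*} : IsReciprocal (0 : σ →₀ ℕ) 1 1 := by
  classical
  refine ⟨fun a ha => ?_, fun a b h => ?_⟩
  · by_contra h
    exact ha (by rw [coeff_one, if_neg]; rintro rfl; exact h le_rfl)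
  · obtain ⟨rfl, rfl⟩ := add_eq_zero.1 h
    simp

theorem IsReciprocal.mul {σ : Type*} {D₁ D₂ : σ →₀ ℕ} {ε₁ ε₂ : ℝ}
    {p q : MvPolynomial σ ℝ} (hp : IsReciprocal D₁ ε₁ p) (hq : IsReciprocal D₂ ε₂ q) :
    IsReciprocal (D₁ + D₂) (ε₁ * ε₂) (p * q) := by
  classical
  refine ⟨fun a ha => ?_, fun a b h => ?_⟩
  · rw [coeff_mul] at ha
    obtain ⟨u, hu, hne⟩ := exists_ne_zero_of_sum_ne_zero ha
    rw [← mem_antidiagonal.1 hu]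
    exact add_le_add (hp.1 _ (left_ne_zero_of_mul hne)) (hq.1 _ (right_ne_zero_of_mul hne))
  · rw [coeff_mul, coeff_mul, mul_sum]
    have key : ∀ u v : σ →₀ ℕ, u ≤ D₁ → v ≤ D₂ → coeff u p * coeff v q =
        ε₁ * ε₂ * (coeff (D₁ - u) p * coeff (D₂ - v) q) := fun u v hu hv => by
      rw [hp.2 u _ (add_tsub_cancel_of_le hu), hq.2 v _ (add_tsub_cancel_of_le hv)]
      ring
    have le₁ : ∀ u v : σ →₀ ℕ, coeff u p * coeff v q ≠ 0 → u ≤ D₁ ∧ v ≤ D₂ := fun u v huv =>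
      ⟨hp.1 _ (left_ne_zero_of_mul huv), hq.1 _ (right_ne_zero_of_mul huv)⟩
    have anti : ∀ (u v c e : σ →₀ ℕ), u ≤ D₁ → v ≤ D₂ → u + v = c → c + e = D₁ + D₂ →
        (D₁ - u) + (D₂ - v) = e := by
      intro u v c e hu hv huv hce
      ext i
      have h1 := DFunLike.congr_fun huv i
      have h2 := DFunLike.congr_fun hce i
      have h3 := hu i
      have h4 := hv i
      simp only [Finsupp.add_apply, Finsupp.tsub_apply] at *
      omega
    refine sum_bij_ne_zero (fun u _ _ => (D₁ - u.1, D₂ - u.2)) ?_ ?_ ?_ ?_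
    · intro u hu hne
      obtain ⟨h1, h2⟩ := le₁ _ _ hne
      exact mem_antidiagonal.2 (anti _ _ _ _ h1 h2 (mem_antidiagonal.1 hu) h)
    · intro u _ hu v _ hv huv
      obtain ⟨h1, h2⟩ := le₁ _ _ hu
      obtain ⟨h3, h4⟩ := le₁ _ _ hv
      obtain ⟨h5, h6⟩ := Prod.mk.inj huv
      exact Prod.ext ((tsub_right_inj h1 h3).1 h5) ((tsub_right_inj h2 h4).1 h6)
    · intro u hu hne
      obtain ⟨h1, h2⟩ := le₁ _ _ (right_ne_zero_of_mul hne)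
      refine ⟨(D₁ - u.1, D₂ - u.2), mem_antidiagonal.2
        (anti _ _ _ _ h1 h2 (mem_antidiagonal.1 hu) (by rw [add_comm, h])), ?_, ?_⟩
      · rw [key _ _ tsub_le_self tsub_le_self, tsub_tsub_cancel_of_le h1,
          tsub_tsub_cancel_of_le h2]
        exact hne
      · simp [tsub_tsub_cancel_of_le h1, tsub_tsub_cancel_of_le h2]
    · intro u _ hne
      obtain ⟨h1, h2⟩ := le₁ _ _ hne
      exact key _ _ h1 h2

theorem IsReciprocal.prod {σ κ : Type*} (s : Finset κ) {D : κ → σ →₀ ℕ} {ε : κ → ℝ}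
    {p : κ → MvPolynomial σ ℝ} (h : ∀ k ∈ s, IsReciprocal (D k) (ε k) (p k)) :
    IsReciprocal (∑ k ∈ s, D k) (∏ k ∈ s, ε k) (∏ k ∈ s, p k) := by
  classical
  induction s using Finset.induction_on with
  | empty => simpa using IsReciprocal.one
  | insert k s hk ih =>
    rw [sum_insert hk, prod_insert hk, prod_insert hk]
    exact (h k (mem_insert_self _ _)).mul (ih fun j hj => h j (mem_insert_of_mem hj))

theorem isReciprocal_X_sub_X {σ : Type*} (i j : σ) :
    IsReciprocal (Finsupp.single i 1 + Finsupp.single j 1) (-1) (X i - X j) := by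
  classical
  refine ⟨fun a ha => ?_, fun a b h => ?_⟩
  · rw [coeff_sub, coeff_X, coeff_X] at ha
    split_ifs at ha with h1 h2 h2
    · simp at ha
    · rw [← h1]; exact le_self_add
    · rw [← h2]; exact le_add_self
    · simp at ha
  · have h1 : Finsupp.single i 1 = a ↔ Finsupp.single j 1 = b :=
      ⟨fun e => by subst e; exact (add_left_cancel h).symm,
        fun e => by subst e; exact (add_right_cancel h).symm⟩
    have h2 : Finsupp.single j 1 = a ↔ Finsupp.single i 1 = b := by
      rw [add_comm (Finsupp.single i 1)] at h
      exact ⟨fun e => by subst e; exact (add_left_cancel h).symm,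
        fun e => by subst e; exact (add_right_cancel h).symm⟩
    rw [coeff_sub, coeff_sub, coeff_X, coeff_X, coeff_X, coeff_X]
    simp only [h1, h2]
    ring

/-- The middle coefficient of the square of a reciprocal polynomial is a signed sum of squares. -/
theorem IsReciprocal.coeff_sq_ne_zero {σ : Type*} {D : σ →₀ ℕ} {ε : ℝ} {p : MvPolynomial σ ℝ}
    (h : IsReciprocal D ε p) (hp : p ≠ 0) : coeff D (p * p) ≠ 0 := by
  classical
  intro h0
  have hsum : ∑ u ∈ antidiagonal D, coeff u.1 p * coeff u.1 p = 0 := by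
    rw [coeff_mul] at h0
    rw [← mul_zero ε, ← h0, mul_sum]
    refine sum_congr rfl fun u hu => ?_
    conv_lhs => rw [h.2 u.1 u.2 (mem_antidiagonal.1 hu)]
    rw [h.2 u.1 u.2 (mem_antidiagonal.1 hu)]
    ring
  rw [sum_eq_zero_iff_of_nonneg fun u _ => mul_self_nonneg _] at hsum
  refine hp (MvPolynomial.ext _ _ fun a => ?_)
  rw [coeff_zero]
  by_contra ha
  exact ha (mul_self_eq_zero.1
    (hsum (a, D - a) (mem_antidiagonal.2 (add_tsub_cancel_of_le (h.1 a ha)))))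

theorem totalDegree_prod_add_C_le {σ κ : Type*} (s : Finset κ) {h : κ → MvPolynomial σ ℝ}
    (hh : ∀ k ∈ s, (h k).IsHomogeneous 1) (c : κ → ℝ) :
    (∏ k ∈ s, (h k + C (c k))).totalDegree ≤ s.card := by
  refine (totalDegree_finsetProd _ _).trans ?_
  rw [card_eq_sum_ones]
  refine sum_le_sum fun k hk => (totalDegree_add _ _).trans ?_
  simpa using (hh k hk).totalDegree_le

/-- Adding constants to linear forms does not change the top coefficients of their product. -/
theorem coeff_prod_add_C {σ κ : Type*} (s : Finset κ) {h : κ → MvPolynomial σ ℝ}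
    (hh : ∀ k ∈ s, (h k).IsHomogeneous 1) (c : κ → ℝ) (t : σ →₀ ℕ) (ht : s.card ≤ t.degree) :
    coeff t (∏ k ∈ s, (h k + C (c k))) = coeff t (∏ k ∈ s, h k) := by
  classical
  induction s using Finset.induction_on generalizing t with
  | empty => simp
  | insert k s hk ih =>
    rw [card_insert_of_notMem hk] at ht
    have hs : ∀ j ∈ s, (h j).IsHomogeneous 1 := fun j hj => hh j (mem_insert_of_mem hj)
    rw [prod_insert hk, prod_insert hk, add_mul, coeff_add, coeff_C_mul,
      coeff_eq_zero_of_totalDegree_lt (f := ∏ j ∈ s, (h j + C (c j))), mul_zero, add_zero,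
      coeff_mul, coeff_mul]
    · refine sum_congr rfl fun u hu => ?_
      by_cases hu1 : u.1.degree = 1
      · rw [ih hs]
        rw [← mem_antidiagonal.1 hu, map_add] at ht
        omega
      · rw [(hh k (mem_insert_self _ _)).coeff_eq_zero hu1, zero_mul, zero_mul]
    · exact ((totalDegree_prod_add_C_le s hs c).trans_lt (Nat.lt_of_succ_le ht))

/-- Numbers can be chosen from lists of size more than `3 * (N - 1)` so that the difference of any
two of them avoids six prescribed values. -/
theorem exists_forall_sub_ne {N : ℕ} (S : Fin N → Finset ℝ) (hS : ∀ i, 3 * (N - 1) < (S i).card)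
    (d : Fin N → Fin N → Fin 6 → ℝ) :
    ∃ x : Fin N → ℝ, (∀ i, x i ∈ S i) ∧ ∀ i j, i < j → ∀ k, x i - x j ≠ d i j k := by
  classical
  set s : Finset (Fin N × Fin N) := univ.filter fun z => z.1 < z.2 with hs
  set T : Finset ((Fin N × Fin N) × Fin 3) := s ×ˢ univ with hT
  set D : Fin N →₀ ℕ := ∑ z ∈ T, (Finsupp.single z.1.1 1 + Finsupp.single z.1.2 1) with hD
  have hne : ∀ z ∈ s, z.1 ≠ z.2 := fun z hz => (mem_filter.1 hz).2.ne
  have hrec : IsReciprocal D (∏ z ∈ T, (-1)) (∏ z ∈ T, (X z.1.1 - X z.1.2)) :=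
    IsReciprocal.prod T fun z _ => isReciprocal_X_sub_X _ _
  have hcoeff := hrec.coeff_sq_ne_zero (prod_ne_zero_iff.2 fun z hz =>
    sub_ne_zero.2 fun e => hne _ (mem_product.1 hz).1 (X_injective e))
  have hprod : (∏ z ∈ T, (X z.1.1 - X z.1.2 : MvPolynomial (Fin N) ℝ)) *
      ∏ z ∈ T, (X z.1.1 - X z.1.2) =
      ∏ z ∈ s ×ˢ (univ : Finset (Fin 6)), (X z.1.1 - X z.1.2) := by
    rw [hT, prod_product, prod_product, ← prod_mul_distrib]
    refine prod_congr rfl fun z _ => ?_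
    simp only [prod_const, card_univ, Fintype.card_fin]
    ring
  rw [hprod] at hcoeff
  have hlin : ∀ z ∈ s ×ˢ (univ : Finset (Fin 6)),
      (X z.1.1 - X z.1.2 : MvPolynomial (Fin N) ℝ).IsHomogeneous 1 := fun z _ =>
    (isHomogeneous_X _ _).sub (isHomogeneous_X _ _)
  have hdeg : D.degree = (s ×ˢ (univ : Finset (Fin 6))).card := by
    by_contra hd
    refine hcoeff ((IsHomogeneous.prod _ _ (fun _ => 1) hlin).coeff_eq_zero ?_)
    simpa using hd
  have hcoeff' := coeff_prod_add_C _ hlin (fun z => - d z.1.1 z.1.2 z.2) D hdeg.ge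
  rw [← hcoeff'] at hcoeff
  have htot := le_antisymm ((totalDegree_prod_add_C_le _ hlin
    (fun z => - d z.1.1 z.1.2 z.2)).trans hdeg.ge) (le_totalDegree (mem_support_iff.2 hcoeff))
  have hDi : ∀ i, D i ≤ 3 * (N - 1) := by
    intro i
    have h1 : ∑ z ∈ s, ((if z.1 = i then 1 else 0) + if z.2 = i then 1 else 0) = N - 1 := by
      rw [hs, sum_filter, ← univ_product_univ, sum_product]
      have h2 : ∀ p q : Fin N, (if p < q then ((if p = i then 1 else 0) + if q = i then 1 else 0)
          else 0) = (if p = i then (if i < q then 1 else 0) else 0) +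
            if q = i then (if p < i then 1 else 0) else 0 := by
        intro p q
        split_ifs <;> first | rfl | (exfalso; subst_vars; order)
      simp only [h2, sum_add_distrib]
      rw [sum_comm]
      simp only [sum_ite_eq', mem_univ, if_true, ← card_filter]
      have h3 : (univ.filter fun q => i < q) = Ioi i := by ext; simp
      have h4 : (univ.filter fun q => q < i) = Iio i := by ext; simp
      rw [h3, h4, Fin.card_Ioi, Fin.card_Iio]
      omega
    rw [hD, Finsupp.finsetSum_apply, hT, sum_product]
    simp only [Finsupp.add_apply, Finsupp.single_apply, sum_const, card_univ, Fintype.card_fin,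
      smul_eq_mul, ← mul_sum]
    rw [h1]
  obtain ⟨x, hxS, hx⟩ := combinatorial_nullstellensatz_exists_eval_nonzero _ D hcoeff htot S
    fun i => (hDi i).trans_lt (hS i)
  refine ⟨x, hxS, fun i j hij k => ?_⟩
  rw [map_prod, prod_ne_zero_iff] at hx
  have := hx ((i, j), k) (by simp [hs, hij])
  intro e
  exact this (by simp [e])

theorem sum_offDiag_add {α : Type*} [DecidableEq α] (s : Finset α) (g : α → ℕ) :
    ∑ z ∈ s.offDiag, (g z.1 + g z.2) = 2 * (s.card - 1) * ∑ x ∈ s, g x := by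
  have h1 : ∑ z ∈ s.offDiag, g z.1 = (s.card - 1) * ∑ x ∈ s, g x := by
    have h : s.offDiag = (s ×ˢ s).filter fun z => z.1 ≠ z.2 := by
      ext; simp [and_assoc]
    rw [h, sum_filter, sum_product, mul_sum]
    refine sum_congr rfl fun x hx => ?_
    simp only [← sum_filter, sum_const, smul_eq_mul, filter_ne, card_erase_of_mem hx]
  have h2 : ∑ z ∈ s.offDiag, g z.2 = ∑ z ∈ s.offDiag, g z.1 :=
    sum_nbij' Prod.swap Prod.swap (by simp; tauto) (by simp; tauto) (by simp) (by simp) (by simp)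
  rw [sum_add_distrib, h2, h1]
  ring

/-- The edges of `A` can be labelled from sufficiently long lists so that the labels are distinct,
the vertices of `U` have distinct weighted sums, and so have the two vertices of each pair in `J`. -/
theorem exists_labeling_of_card_lt {V : Type*} [Fintype V] [DecidableEq V]
    (A : Finset (Sym2 V)) (U : Finset V) (J : Finset (V × V)) (ω : V → ℝ)
    (L : Sym2 V → Finset ℝ)
    (hU : ∀ u ∈ U, ∃ e ∈ A, u ∈ e ∧ ∀ u' ∈ U, u' ∈ e → u' = u)
    (hUA : ∀ e ∈ A, (U.filter (· ∈ e)).card ≤ 1)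
    (hJ : ∀ z ∈ J, ∃ e ∈ A, ¬ (z.1 ∈ e ↔ z.2 ∈ e))
    (hJA : ∀ e ∈ A, ∑ z ∈ J, ((if z.1 ∈ e then 1 else 0) + if z.2 ∈ e then 1 else 0) ≤ 2)
    (hL : ∀ e ∈ A, 2 * (A.card - 1) + 2 * (U.card - 1) + 2 < (L e).card) :
    ∃ f : Sym2 V → ℝ, (∀ e ∈ A, f e ∈ L e) ∧ (∀ e ∉ A, f e = 0) ∧
      (∀ e ∈ A, ∀ e' ∈ A, e ≠ e' → f e ≠ f e') ∧
      (∀ u ∈ U, ∀ u' ∈ U, u ≠ u' → ω u + ∑ e ∈ A.filter (u ∈ ·), f e ≠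
        ω u' + ∑ e ∈ A.filter (u' ∈ ·), f e) ∧
      ∀ z ∈ J, ω z.1 + ∑ e ∈ A.filter (z.1 ∈ ·), f e ≠ ω z.2 + ∑ e ∈ A.filter (z.2 ∈ ·), f e := by
  set p : V → MvPolynomial (Sym2 V) ℝ := fun v => C (ω v) + ∑ e ∈ A.filter (v ∈ ·), X e with hp
  have hpe : ∀ (f : Sym2 V → ℝ) v, eval f (p v) = ω v + ∑ e ∈ A.filter (v ∈ ·), f e := by
    intro f v; simp [hp]
  have hpc : ∀ v, ∀ e ∈ A, coeff (Finsupp.single e 1) (p v) = if v ∈ e then 1 else 0 := by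
    intro v e he
    simp only [hp, coeff_add, coeff_C, coeff_sum, coeff_X, Finsupp.single_left_inj one_ne_zero]
    rw [if_neg (by simp [eq_comm]), sum_ite_eq', zero_add]
    simp [he]
  have hpd : ∀ v e, degreeOf e (p v) ≤ if e ∈ A ∧ v ∈ e then 1 else 0 := by
    intro v e
    refine (degreeOf_add_le _ _ _).trans (max_le (by simp) ((degreeOf_sum_le _ _ _).trans ?_))
    refine Finset.sup_le fun e' he' => ?_
    rw [degreeOf_X]
    split_ifs with h1 h2
    · rfl
    · subst h1; exact absurd (mem_filter.1 he') h2
    · omega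
    · omega
  have hpsub : ∀ v w, ∀ e ∈ A, ¬ (v ∈ e ↔ w ∈ e) → p v - p w ≠ 0 := by
    intro v w e he hvw h
    have := congrArg (coeff (Finsupp.single e 1)) (sub_eq_zero.1 h)
    rw [hpc v e he, hpc w e he] at this
    split_ifs at this <;> simp_all
  set P₁ : MvPolynomial (Sym2 V) ℝ := ∏ z ∈ A.offDiag, (X z.1 - X z.2) with hP₁
  set P₂ : MvPolynomial (Sym2 V) ℝ := ∏ z ∈ U.offDiag, (p z.1 - p z.2) with hP₂
  set P₃ : MvPolynomial (Sym2 V) ℝ := ∏ z ∈ J, (p z.1 - p z.2) with hP₃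
  have hne : P₁ * P₂ * P₃ ≠ 0 := by
    refine mul_ne_zero (mul_ne_zero ?_ ?_) ?_ <;> refine prod_ne_zero_iff.2 fun z hz => ?_
    · exact sub_ne_zero.2 fun h => (mem_offDiag.1 hz).2.2 (X_injective h)
    · obtain ⟨h1, h2, h3⟩ := mem_offDiag.1 hz
      obtain ⟨e, he, hze, hu⟩ := hU _ h1
      exact hpsub _ _ e he fun h => h3 (hu _ h2 (h.1 hze)).symm
    · obtain ⟨e, he, h⟩ := hJ z hz
      exact hpsub _ _ e he h
  have hdiff : ∀ v w e, degreeOf e (p v - p w) ≤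
      (if e ∈ A ∧ v ∈ e then 1 else 0) + if e ∈ A ∧ w ∈ e then 1 else 0 := fun v w e =>
    (degreeOf_sub_le _ _ _).trans (max_le ((hpd v e).trans (Nat.le_add_right _ _))
      ((hpd w e).trans (Nat.le_add_left _ _)))
  have hd₁ : ∀ e, degreeOf e P₁ ≤ 2 * (A.card - 1) * ∑ x ∈ A, if x = e then 1 else 0 := by
    intro e
    rw [← sum_offDiag_add]
    refine (degreeOf_prod_le _ _ _).trans (sum_le_sum fun z _ => (degreeOf_sub_le _ _ _).trans ?_)
    rw [degreeOf_X, degreeOf_X]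
    simp only [eq_comm (a := e)]
    omega
  have hd₂ : ∀ e, degreeOf e P₂ ≤
      2 * (U.card - 1) * ∑ x ∈ U, if e ∈ A ∧ x ∈ e then 1 else 0 := by
    intro e
    rw [← sum_offDiag_add]
    exact (degreeOf_prod_le _ _ _).trans (sum_le_sum fun z _ => hdiff _ _ _)
  have hd₃ : ∀ e, degreeOf e P₃ ≤ ∑ z ∈ J, ((if e ∈ A ∧ z.1 ∈ e then 1 else 0) +
      if e ∈ A ∧ z.2 ∈ e then 1 else 0) := fun e =>
    (degreeOf_prod_le _ _ _).trans (sum_le_sum fun z _ => hdiff _ _ _)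
  have hdeg : ∀ e, degreeOf e (P₁ * P₂ * P₃) <
      ((fun e => if e ∈ A then L e else {0}) e : Finset ℝ).card := by
    intro e
    have h := (degreeOf_mul_le e (P₁ * P₂) P₃).trans
      (add_le_add_left (degreeOf_mul_le e P₁ P₂) _)
    have h1 := hd₁ e
    have h2 := hd₂ e
    have h3 := hd₃ e
    by_cases he : e ∈ A
    · simp only [he, true_and, if_true, sum_ite_eq', mul_one] at h1 h2 h3 ⊢
      rw [← card_filter] at h2
      have h4 := h2.trans (Nat.mul_le_mul_left _ (hUA e he))
      have h5 := hJA e he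
      have h6 := hL e he
      omega
    · simp only [he, false_and, if_false, sum_ite_eq', mul_zero, sum_const_zero, add_zero,
        card_singleton] at h1 h2 h3 ⊢
      omega
  have hex : ∃ f : Sym2 V → ℝ, (∀ e, f e ∈ (fun e => if e ∈ A then L e else {0}) e) ∧
      eval f (P₁ * P₂ * P₃) ≠ 0 := by
    by_contra! hcon
    exact hne (eq_zero_of_eval_zero_at_prod_finset _ _ hdeg hcon)
  obtain ⟨f, hf, hev⟩ := hex
  simp only [hP₁, hP₂, hP₃, map_mul, map_prod, map_sub, eval_X, hpe, mul_ne_zero_iff,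
    prod_ne_zero_iff, sub_ne_zero] at hev
  obtain ⟨⟨h1, h2⟩, h3⟩ := hev
  refine ⟨f, fun e he => by simpa [he] using hf e, fun e he => by simpa [he] using hf e,
    fun e he e' he' hee => h1 (e, e') (mem_offDiag.2 ⟨he, he', hee⟩),
    fun u hu u' hu' huu => h2 (u, u') (mem_offDiag.2 ⟨hu, hu', huu⟩), h3⟩

/-- A graph has a matching `a i, b i` that cannot be enlarged. -/
theorem exists_maximum_matching {V : Type*} [Fintype V] (G : SimpleGraph V) :
    ∃ (N : ℕ) (a b : Fin N → V), (∀ i, G.Adj (a i) (b i)) ∧ (Sum.elim a b).Injective ∧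
      ∀ a' b' : Option (Fin N) → V, (∀ i, G.Adj (a' i) (b' i)) →
        ¬ (Sum.elim a' b').Injective := by
  classical
  set p : ℕ → Prop := fun N => ∃ a b : Fin N → V, (∀ i, G.Adj (a i) (b i)) ∧
    (Sum.elim a b).Injective with hp
  have h0 : p 0 := ⟨Fin.elim0, Fin.elim0, fun i => i.elim0,
    Function.injective_of_subsingleton _⟩
  have hbound : ∀ N, p N → N ≤ Fintype.card V := by
    rintro N ⟨a, b, -, hab⟩
    have := Fintype.card_le_of_injective _ hab
    simp only [Fintype.card_sum, Fintype.card_fin] at this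
    omega
  set M := Nat.findGreatest p (Fintype.card V) with hM
  obtain ⟨a, b, hadj, hinj⟩ : p M := Nat.findGreatest_spec (Nat.zero_le (Fintype.card V)) h0
  refine ⟨M, a, b, hadj, hinj, fun a' b' hadj' hinj' => ?_⟩
  have hp1 : p (M + 1) := by
    refine ⟨a' ∘ finSuccEquiv M, b' ∘ finSuccEquiv M, fun i => hadj' _, ?_⟩
    have : Sum.elim (a' ∘ finSuccEquiv M) (b' ∘ finSuccEquiv M) =
        Sum.elim a' b' ∘ Sum.map (finSuccEquiv M) (finSuccEquiv M) := by
      rw [Sum.elim_comp_map]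
    rw [this]
    exact hinj'.comp ((finSuccEquiv M).injective.sumMap (finSuccEquiv M).injective)
  have := Nat.le_findGreatest (hbound _ hp1) hp1
  omega

/-- In a maximum matching of a graph of maximum degree at most `2`, the non-isolated vertices left
uncovered are pairwise nonadjacent, and there are at most as many of them as edges in the
matching. -/
theorem uncovered_of_maximum_matching {V : Type*} [Fintype V] [DecidableEq V] {G : SimpleGraph V}
    (hmax : ∀ v : V, Nat.card (G.neighborSet v) ≤ 2) {N : ℕ} {a b : Fin N → V}
    (hadj : ∀ i, G.Adj (a i) (b i)) (hinj : (Sum.elim a b).Injective)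
    (haug : ∀ a' b' : Option (Fin N) → V, (∀ i, G.Adj (a' i) (b' i)) →
      ¬ (Sum.elim a' b').Injective)
    (U : Finset V) (hU : ∀ u ∈ U, (∃ w, G.Adj u w) ∧ ∀ i, u ≠ a i ∧ u ≠ b i)
    (hU' : ∀ v w, G.Adj v w → v ∉ U → ∃ i, v = a i ∨ v = b i) :
    (∀ u ∈ U, ∀ u' ∈ U, ¬ G.Adj u u') ∧ U.card ≤ N := by
  have hthree : ∀ v x y z : V, G.Adj v x → G.Adj v y → G.Adj v z → x ≠ y → x ≠ z → y ≠ z →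
      False := by
    intro v x y z hx hy hz hxy hxz hyz
    have h1 : (({x, y, z} : Finset V) : Set V) ⊆ G.neighborSet v := by
      intro w hw
      simp only [coe_insert, coe_singleton, Set.mem_insert_iff, Set.mem_singleton_iff] at hw
      rcases hw with rfl | rfl | rfl <;> assumption
    have h2 := Set.ncard_le_ncard h1 (Set.toFinite _)
    rw [Set.ncard_coe_finset, card_eq_three.2 ⟨x, y, z, hxy, hxz, hyz, rfl⟩] at h2
    have h3 := hmax v
    rw [Nat.card_coe_set_eq] at h3
    omega
  have ha : ∀ i j, a i = a j → i = j := fun i j h => by simpa using @hinj (.inl i) (.inl j) h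
  have hb : ∀ i j, b i = b j → i = j := fun i j h => by simpa using @hinj (.inr i) (.inr j) h
  have hab : ∀ i j, a i ≠ b j := fun i j h => by simpa using @hinj (.inl i) (.inr j) h
  have hind : ∀ u ∈ U, ∀ u' ∈ U, ¬ G.Adj u u' := by
    intro u hu u' hu' huu
    have h1 := (hU u hu).2
    have h2 := (hU u' hu').2
    have h3 := huu.ne
    refine haug (fun o => o.elim u a) (fun o => o.elim u' b) (by rintro (_ | i) <;> simp [*]) ?_
    rintro ((_ | i) | (_ | i)) ((_ | j) | (_ | j)) <;> simp <;> grind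
  refine ⟨hind, ?_⟩
  have hswap : ∀ u ∈ U, ∀ u' ∈ U, u ≠ u' → ∀ i, G.Adj u (a i) → G.Adj u' (b i) → False := by
    intro u hu u' hu' huu i hi hi'
    have h1 := (hU u hu).2
    have h2 := (hU u' hu').2
    refine haug (fun o => o.elim u' a) (fun o => o.elim (b i) (Function.update b i u)) ?_ ?_
    · rintro (_ | j)
      · exact hi'
      · by_cases hj : j = i
        · subst hj; simpa using hi.symm
        · simpa [hj] using hadj j
    · clear hthree hU' hind haug hmax hU
      rintro ((_ | j) | (_ | j)) ((_ | k) | (_ | k)) <;> simp [Function.update_apply] <;> grind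
  have hex : ∀ u ∈ U, ∃ i : Fin N, G.Adj u (a i) ∨ G.Adj u (b i) := by
    intro u hu
    obtain ⟨w, hw⟩ := (hU u hu).1
    obtain ⟨i, rfl | rfl⟩ := hU' w u hw.symm fun h => hind u hu w h hw
    exacts [⟨i, .inl hw⟩, ⟨i, .inr hw⟩]
  rcases U.eq_empty_or_nonempty with rfl | ⟨u₀, hu₀⟩
  · simp
  have : Nonempty (Fin N) := ⟨(hex u₀ hu₀).choose⟩
  choose! φ hφ using hex
  have hcard : U.card ≤ (univ : Finset (Fin N)).card := by
    refine card_le_card_of_injOn φ (fun _ _ => mem_univ _) fun u hu u' hu' h => ?_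
    by_contra huu
    have h1 := (hU u hu).2 (φ u)
    have h2 := (hU u' hu').2 (φ u)
    rcases hφ u hu with h3 | h3 <;> rcases hφ u' hu' with h4 | h4 <;> rw [← h] at h4
    · exact hthree _ _ _ _ (hadj (φ u)) h3.symm h4.symm h1.2.symm h2.2.symm huu
    · exact hswap u hu u' hu' huu _ h3 h4
    · exact hswap u' hu' u hu (Ne.symm huu) _ h4 h3
    · exact hthree _ _ _ _ (hadj (φ u)).symm h3.symm h4.symm h1.1.symm h2.1.symm huu
  simpa using hcard

/-- If `G` is a graph on `n` vertices with maximum degree at most `2`, then `G` is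
`⌊4n/3⌋`-list-weighted-quasi-antimagic. -/
theorem statement_3 {V : Type*} [Fintype V] (G : SimpleGraph V)
    (hmax : ∀ v : V, Nat.card (G.neighborSet v) ≤ 2) :
    ListWeightedQuasiAntimagic G ((4 * Fintype.card V) / 3) := by
  classical
  intro ω L hL
  obtain ⟨N, a, b, hadj, hinj, haug⟩ := exists_maximum_matching G
  have ha : ∀ i j, a i = a j → i = j := fun i j h => by simpa using @hinj (.inl i) (.inl j) h
  have hb : ∀ i j, b i = b j → i = j := fun i j h => by simpa using @hinj (.inr i) (.inr j) h
  have hab : ∀ i j, a i ≠ b j := fun i j h => by simpa using @hinj (.inl i) (.inr j) h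
  have hM : ∀ i j, s(a i, b i) = s(a j, b j) → i = j := by
    intro i j h
    rcases Sym2.eq_iff.1 h with h | h
    exacts [ha _ _ h.1, (hab _ _ h.1).elim]
  set E : Finset (Sym2 V) := univ.filter (· ∈ G.edgeSet) with hE
  have hEm : Nat.card G.edgeSet = E.card := by
    rw [Nat.card_eq_fintype_card, Fintype.card_subtype]
  have hmemE : ∀ e, e ∈ E ↔ e ∈ G.edgeSet := fun e => by simp [hE]
  have hME : ∀ i, s(a i, b i) ∈ E := fun i => (hmemE _).2 (hadj i)
  set A : Finset (Sym2 V) := E.filter fun e => ∀ i, e ≠ s(a i, b i) with hA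
  have hmemA : ∀ e, e ∈ A ↔ e ∈ E ∧ ∀ i, e ≠ s(a i, b i) := fun e => by simp [hA]
  have hAcard : A.card + N = E.card := by
    have h1 : E.filter (fun e => ¬ ∀ i, e ≠ s(a i, b i)) = univ.image fun i => s(a i, b i) := by
      ext e
      simp only [mem_filter, mem_image, mem_univ, true_and, not_forall, not_not]
      exact ⟨fun ⟨_, i, h⟩ => ⟨i, h.symm⟩, fun ⟨i, h⟩ => ⟨h ▸ hME i, i, h.symm⟩⟩
    have h2 := card_filter_add_card_filter_not (s := E) (fun e => ∀ i, e ≠ s(a i, b i))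
    rw [h1, card_image_of_injective _ hM, card_univ, Fintype.card_fin] at h2
    exact h2
  set U : Finset V := univ.filter fun u => (∃ w, G.Adj u w) ∧ ∀ i, u ≠ a i ∧ u ≠ b i with hUdef
  have hmemU : ∀ u, u ∈ U ↔ (∃ w, G.Adj u w) ∧ ∀ i, u ≠ a i ∧ u ≠ b i := fun u => by
    simp [hUdef]
  have hcov : ∀ v w, G.Adj v w → v ∉ U → ∃ i, v = a i ∨ v = b i := by
    intro v w hvw hv
    by_contra! h
    exact hv ((hmemU v).2 ⟨⟨w, hvw⟩, h⟩)
  obtain ⟨hind, hUN⟩ := uncovered_of_maximum_matching hmax hadj hinj haug U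
    (fun u hu => (hmemU u).1 hu) hcov
  have hVcard : 2 * N + U.card ≤ Fintype.card V := by
    have h1 : Disjoint (univ.image (Sum.elim a b)) U := by
      rw [disjoint_left]
      intro v hv hvU
      obtain ⟨k, -, rfl⟩ := mem_image.1 hv
      rcases k with i | i
      exacts [(((hmemU _).1 hvU).2 i).1 rfl, (((hmemU _).1 hvU).2 i).2 rfl]
    have h2 := card_le_univ (univ.image (Sum.elim a b) ∪ U)
    rw [card_union_of_disjoint h1, card_image_of_injective _ hinj, card_univ, Fintype.card_sum,
      Fintype.card_fin] at h2
    omega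
  have hEV : E.card ≤ Fintype.card V := by
    have h1 := G.sum_degrees_eq_twice_card_edges
    have h2 : G.edgeFinset = E := by ext; simp [hE]
    have h3 : ∑ v, G.degree v ≤ ∑ _v : V, 2 := sum_le_sum fun v _ => by
      have := hmax v
      rwa [Nat.card_eq_fintype_card, G.card_neighborSet_eq_degree] at this
    rw [h1, h2, sum_const, card_univ, smul_eq_mul] at h3
    omega
  set J : Finset (V × V) :=
    (univ.filter fun i => ∃ e ∈ A, a i ∈ e ∨ b i ∈ e).image fun i => (a i, b i) with hJdef
  have hcount : ∀ e : Sym2 V, ∑ i, ((if a i ∈ e then 1 else 0) + if b i ∈ e then 1 else 0) ≤ 2 := by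
    intro e
    induction e using Sym2.ind with
    | h x y =>
    have h1 : ∑ k, (if Sum.elim a b k ∈ s(x, y) then 1 else 0) ≤ 2 := by
      rw [← card_filter, ← card_image_of_injective _ hinj]
      refine (card_le_card (t := {x, y}) fun v hv => ?_).trans card_le_two
      obtain ⟨k, hk, rfl⟩ := mem_image.1 hv
      simpa using (mem_filter.1 hk).2
    rw [sum_add_distrib]
    simp only [Fintype.sum_sum_type, Sum.elim_inl, Sum.elim_inr] at h1
    convert h1 using 3 <;> congr
  obtain ⟨f₀, hf₀L, hf₀z, hf₀A, hf₀U, hf₀J⟩ := exists_labeling_of_card_lt A U J ω L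
    (by
      intro u hu
      obtain ⟨⟨w, hw⟩, hu'⟩ := (hmemU u).1 hu
      refine ⟨s(u, w), (hmemA _).2 ⟨(hmemE _).2 hw, fun i h => ?_⟩, Sym2.mem_mk_left _ _, ?_⟩
      · rcases Sym2.eq_iff.1 h with h | h
        exacts [(hu' i).1 h.1, (hu' i).2 h.1]
      · intro v hv hve
        rcases Sym2.mem_iff.1 hve with rfl | rfl
        exacts [rfl, (hind u hu v hv hw).elim])
    (by
      intro e he
      rw [card_le_one]
      intro u hu v hv
      obtain ⟨hu, hue⟩ := mem_filter.1 hu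
      obtain ⟨hv, hve⟩ := mem_filter.1 hv
      by_contra huv
      have he' := (hmemE _).1 ((hmemA _).1 he).1
      rw [(Sym2.mem_and_mem_iff huv).1 ⟨hue, hve⟩] at he'
      exact hind u hu v hv he')
    (by
      intro z hz
      obtain ⟨i, hi, rfl⟩ := mem_image.1 hz
      obtain ⟨e, he, h⟩ := (mem_filter.1 hi).2
      refine ⟨e, he, fun hiff => ((hmemA _).1 he).2 i ?_⟩
      refine (Sym2.mem_and_mem_iff (hab i i)).1 ?_
      simp only at hiff
      tauto)
    (by
      intro e _
      rw [hJdef, sum_image fun i _ j _ h => ha i j (Prod.mk.inj h).1]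
      exact (sum_le_sum_of_subset (subset_univ _)).trans (hcount e))
    (by
      intro e he
      have h1 := hL e ((hmemE _).1 ((hmemA _).1 he).1)
      have h2 : 0 < N := by
        have he' := (hmemE _).1 ((hmemA _).1 he).1
        induction e using Sym2.ind with
        | h x y =>
        by_cases hx : x ∈ U
        · obtain ⟨i, -⟩ := hcov y x he'.symm fun hy => hind x hx y hy he'
          exact i.pos
        · obtain ⟨i, -⟩ := hcov x y he' hx
          exact i.pos
      have h3 : 0 < A.card := card_pos.2 ⟨e, he⟩
      rw [hEm] at h1
      omega)
  set c : V → ℝ := fun v => ω v + ∑ e ∈ A.filter (v ∈ ·), f₀ e with hc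
  obtain ⟨x, hxS, hx⟩ := exists_forall_sub_ne
    (fun i => L s(a i, b i) \
      (A.image f₀ ∪ (U.image (fun u => c u - c (a i)) ∪ U.image fun u => c u - c (b i))))
    (by
      intro i
      have h1 := hL s(a i, b i) (hadj i)
      have h2 := le_card_sdiff
        (A.image f₀ ∪ (U.image (fun u => c u - c (a i)) ∪ U.image fun u => c u - c (b i)))
        (L s(a i, b i))
      have h3 := card_union_le (A.image f₀)
        (U.image (fun u => c u - c (a i)) ∪ U.image fun u => c u - c (b i))
      have h4 := card_union_le (U.image fun u => c u - c (a i)) (U.image fun u => c u - c (b i))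
      have h5 := card_image_le (s := A) (f := f₀)
      have h6 := card_image_le (s := U) (f := fun u => c u - c (a i))
      have h7 := card_image_le (s := U) (f := fun u => c u - c (b i))
      have h8 := i.pos
      rw [hEm] at h1
      omega)
    (fun i j => ![0, c (a j) - c (a i), c (b j) - c (b i), c (a j) - c (b i), c (b j) - c (a i), 0])
  have hxL : ∀ i, x i ∈ L s(a i, b i) := fun i => (mem_sdiff.1 (hxS i)).1
  have hxA : ∀ i, ∀ e ∈ A, f₀ e ≠ x i := fun i e he h => (mem_sdiff.1 (hxS i)).2
    (mem_union_left _ (mem_image.2 ⟨e, he, h⟩))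
  have hxa : ∀ i, ∀ u ∈ U, c u ≠ c (a i) + x i := fun i u hu h => (mem_sdiff.1 (hxS i)).2
    (mem_union_right _ (mem_union_left _ (mem_image.2 ⟨u, hu, by rw [h]; ring⟩)))
  have hxb : ∀ i, ∀ u ∈ U, c u ≠ c (b i) + x i := fun i u hu h => (mem_sdiff.1 (hxS i)).2
    (mem_union_right _ (mem_union_right _ (mem_image.2 ⟨u, hu, by rw [h]; ring⟩)))
  have hxx : ∀ i j, i ≠ j → x i ≠ x j ∧ c (a i) + x i ≠ c (a j) + x j ∧
      c (b i) + x i ≠ c (b j) + x j ∧ c (a i) + x i ≠ c (b j) + x j ∧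
      c (b i) + x i ≠ c (a j) + x j := by
    intro i j hij
    rcases lt_or_gt_of_ne hij with h | h
    · have h0 := hx i j h 0
      have h1 := hx i j h 1
      have h2 := hx i j h 2
      have h3 := hx i j h 3
      have h4 := hx i j h 4
      simp only [Fin.isValue, Matrix.cons_val] at h0 h1 h2 h3 h4
      refine ⟨fun e => h0 ?_, fun e => h1 ?_, fun e => h2 ?_, fun e => h4 ?_, fun e => h3 ?_⟩ <;>
        linarith
    · have h0 := hx j i h 0
      have h1 := hx j i h 1
      have h2 := hx j i h 2
      have h3 := hx j i h 3
      have h4 := hx j i h 4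
      simp only [Fin.isValue, Matrix.cons_val] at h0 h1 h2 h3 h4
      refine ⟨fun e => h0 ?_, fun e => h1 ?_, fun e => h2 ?_, fun e => h3 ?_, fun e => h4 ?_⟩ <;>
        linarith
  set f : Sym2 V → ℝ := fun e => f₀ e + ∑ i, if e = s(a i, b i) then x i else 0 with hf
  have hfA : ∀ e ∈ A, f e = f₀ e := by
    intro e he
    simp only [hf, ((hmemA e).1 he).2, if_false, sum_const_zero, add_zero]
  have hfM : ∀ i, f s(a i, b i) = x i := by
    intro i
    simp only [hf]
    rw [hf₀z _ fun h => ((hmemA _).1 h).2 i rfl, zero_add, sum_eq_single i]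
    · simp
    · intro j _ hji
      rw [if_neg fun h => hji (hM _ _ h).symm]
    · simp
  have hcases : ∀ e ∈ G.edgeSet, e ∈ A ∨ ∃ i, e = s(a i, b i) := by
    intro e he
    by_contra! h
    exact h.1 ((hmemA e).2 ⟨(hmemE e).2 he, h.2⟩)
  have hsum : ∀ v, weightedSum G ω f v = c v + ∑ i, if v ∈ s(a i, b i) then x i else 0 := by
    intro v
    have h1 : (G.incidenceSet v).toFinite.toFinset = E.filter (v ∈ ·) := by
      ext e
      simp [SimpleGraph.incidenceSet, hE]
    have h2 : ∑ e ∈ E.filter (v ∈ ·), f₀ e = ∑ e ∈ A.filter (v ∈ ·), f₀ e := by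
      refine (sum_subset (filter_subset_filter _ (filter_subset _ _)) fun e he he' =>
        hf₀z e fun h => he' (mem_filter.2 ⟨h, (mem_filter.1 he).2⟩)).symm
    rw [weightedSum, h1]
    simp only [hf, hc, sum_add_distrib, h2, add_assoc]
    rw [sum_comm]
    simp only [sum_ite_eq', mem_filter, hME, true_and]
  have hsa : ∀ i, weightedSum G ω f (a i) = c (a i) + x i := by
    intro i
    rw [hsum, sum_eq_single i]
    · simp
    · intro j _ hji
      rw [if_neg]
      rw [Sym2.mem_iff]
      rintro (h | h)
      exacts [hji (ha _ _ h).symm, hab _ _ h]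
    · simp
  have hsb : ∀ i, weightedSum G ω f (b i) = c (b i) + x i := by
    intro i
    rw [hsum, sum_eq_single i]
    · simp
    · intro j _ hji
      rw [if_neg]
      rw [Sym2.mem_iff]
      rintro (h | h)
      exacts [hab _ _ h.symm, hji (hb _ _ h).symm]
    · simp
  have hsU : ∀ u ∈ U, weightedSum G ω f u = c u := by
    intro u hu
    rw [hsum, sum_eq_zero, add_zero]
    intro i _
    rw [if_neg]
    rw [Sym2.mem_iff]
    rintro (h | h)
    exacts [(((hmemU u).1 hu).2 i).1 h, (((hmemU u).1 hu).2 i).2 h]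
  have hsame : ∀ i, ¬ (G.Adj (a i) (b i) ∧ Nat.card (G.neighborSet (a i)) = 1 ∧
      Nat.card (G.neighborSet (b i)) = 1) → c (a i) ≠ c (b i) := by
    intro i h
    have hother : ∀ v w, G.Adj v w → Nat.card (G.neighborSet v) ≠ 1 →
        ∃ y, y ≠ w ∧ G.Adj v y := by
      intro v w hvw hv
      by_contra! hcon
      refine hv ?_
      have : G.neighborSet v = {w} := by
        ext y
        exact ⟨fun hy => by_contra fun hyw => hcon y hyw hy, fun hy => by
          rw [Set.mem_singleton_iff.1 hy]; exact hvw⟩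
      rw [this]
      simp
    refine hf₀J (a i, b i) (mem_image.2 ⟨i, mem_filter.2 ⟨mem_univ _, ?_⟩, rfl⟩)
    by_cases h1 : Nat.card (G.neighborSet (a i)) = 1
    · have h2 : Nat.card (G.neighborSet (b i)) ≠ 1 := fun h2 => h ⟨hadj i, h1, h2⟩
      obtain ⟨y, hy, hby⟩ := hother _ _ (hadj i).symm h2
      refine ⟨s(b i, y), (hmemA _).2 ⟨(hmemE _).2 hby, fun j hj => ?_⟩,
        .inr (Sym2.mem_mk_left _ _)⟩
      rcases Sym2.eq_iff.1 hj with h | h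
      · exact hab _ _ h.1.symm
      · obtain rfl := hb _ _ h.1
        exact hy h.2
    · obtain ⟨y, hy, hay⟩ := hother _ _ (hadj i) h1
      refine ⟨s(a i, y), (hmemA _).2 ⟨(hmemE _).2 hay, fun j hj => ?_⟩,
        .inl (Sym2.mem_mk_left _ _)⟩
      rcases Sym2.eq_iff.1 hj with h | h
      · obtain rfl := ha _ _ h.1
        exact hy h.2
      · exact hab _ _ h.1
  have hpos : ∀ v, 1 ≤ Nat.card (G.neighborSet v) → v ∈ U ∨ ∃ i, v = a i ∨ v = b i := by
    intro v hv
    have : Nonempty (G.neighborSet v) := (Nat.card_pos_iff.1 hv).1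
    obtain ⟨w, hw⟩ := this
    by_cases h : v ∈ U
    exacts [.inl h, .inr (hcov v w hw h)]
  refine ⟨f, ?_, ?_, ?_⟩
  · intro e he
    rcases hcases e he with h | ⟨i, rfl⟩
    · rw [hfA e h]; exact hf₀L e h
    · rw [hfM]; exact hxL i
  · intro e he e' he' hne
    rcases hcases e he with h | ⟨i, rfl⟩ <;> rcases hcases e' he' with h' | ⟨j, rfl⟩
    · rw [hfA e h, hfA e' h']; exact hf₀A e h e' h' hne
    · rw [hfA e h, hfM]; exact hxA j e h
    · rw [hfA e' h', hfM]; exact (hxA i e' h').symm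
    · rw [hfM, hfM]; exact (hxx i j fun h => hne (by rw [h])).1
  · intro u w huw hu hw hK
    rcases hpos u hu with h | ⟨i, rfl | rfl⟩ <;> rcases hpos w hw with h' | ⟨j, rfl | rfl⟩
    · rw [hsU u h, hsU w h']; exact hf₀U u h w h' huw
    · rw [hsU u h, hsa]; exact hxa j u h
    · rw [hsU u h, hsb]; exact hxb j u h
    · rw [hsU w h', hsa]; exact (hxa i w h').symm
    · rw [hsa, hsa]; exact (hxx i j fun h => huw (by rw [h])).2.1
    · rw [hsa, hsb]
      rcases eq_or_ne i j with rfl | hij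
      · exact fun h => hsame i hK (add_right_cancel h)
      · exact (hxx i j hij).2.2.2.1
    · rw [hsU w h', hsb]; exact (hxb i w h').symm
    · rw [hsb, hsa]
      rcases eq_or_ne i j with rfl | hij
      · exact fun h => hsame i (fun hk => hK ⟨hk.1.symm, hk.2.2, hk.2.1⟩)
          (add_right_cancel h).symm
      · exact (hxx i j hij).2.2.2.2
    · rw [hsb, hsb]; exact (hxx i j fun h => huw (by rw [h])).2.2.1
end
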